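/- Let X be a Banach space and 1 ≤ p < ∞. Then X has the UMD⁻ property if and only if for every X-valued martingale difference sequence (d_n)_{n=1}^m one has E sup_{m≥1} ‖Σ_{n=1}^m d_n‖^p ≲_{p,X} E ‖(d_n)_{n=1}^∞‖_{γ(ℓ²,X)}^p. -/

import Mathlib

open MeasureTheory ProbabilityTheory Filter
open scoped ENNReal NNReal Topology RealInnerProductSpace Classical

noncomputable section

/-- The law of `N` i.i.d. standard Gaussian random variables. -/
def gaussianPi (N : ℕ) : Measure (Fin N → ℝ) :=
  Measure.pi fun _ => gaussianReal 0 1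

/-- The `γ(ℓ²,X)`-norm of a sequence `(d_n)` in a Banach space `X`:
`(E_γ ‖Σ_n γ_n d_n‖²)^{1/2}` with `(γ_n)` i.i.d. standard Gaussians. -/
noncomputable def gammaSeqNorm {X : Type*} [NormedAddCommGroup X] [NormedSpace ℝ X]
    (d : ℕ → X) : ℝ≥0∞ :=
  ⨆ N : ℕ, (∫⁻ g : Fin N → ℝ, (‖∑ i : Fin N, g i • d i‖₊ : ℝ≥0∞) ^ 2 ∂ gaussianPi N) ^ (1 / 2 : ℝ)

/-- `(d_n)` is an `X`-valued martingale difference sequence w.r.t. the filtration `ℱ`,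
i.e. the partial sums `f_m = Σ_{n<m} d_n` form a martingale. -/
def IsMartDiffSeq {Ω X : Type*} [NormedAddCommGroup X] [NormedSpace ℝ X] [CompleteSpace X]
    {m : MeasurableSpace Ω} (ℱ : Filtration ℕ m) (P : Measure Ω) (d : ℕ → Ω → X) : Prop :=
  Martingale (fun n ω => ∑ j ∈ Finset.range n, d j ω) ℱ P

/-- `X` is a UMD⁻ Banach space: for all `p ∈ (1,∞)` there is `β > 0` such that for every
martingale difference sequence `(d_j)`,
`(E‖Σ_{j<n} d_j‖^p)^{1/p} ≤ β (E_r E‖Σ_{j<n} r_j d_j‖^p)^{1/p}`, where the expectation over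
independent Rademacher variables `(r_j)` is written as the normalized sum over sign patterns. -/
def IsUMDminus (X : Type*) [NormedAddCommGroup X] [NormedSpace ℝ X] [CompleteSpace X] : Prop :=
  ∀ p : ℝ, 1 < p → ∃ β : ℝ, 0 < β ∧
    ∀ (Ω : Type) (m : MeasurableSpace Ω) (P : Measure Ω), IsProbabilityMeasure P →
      ∀ (ℱ : Filtration ℕ m) (d : ℕ → Ω → X), IsMartDiffSeq ℱ P d →
        ∀ n : ℕ,
          (∫⁻ ω, (‖∑ j ∈ Finset.range n, d j ω‖₊ : ℝ≥0∞) ^ p ∂P) ^ (1 / p) ≤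
            ENNReal.ofReal β *
              ((∑ e : Fin n → Bool, ∫⁻ ω,
                  (‖∑ j : Fin n, (if e j then (1 : ℝ) else -1) • d j ω‖₊ : ℝ≥0∞) ^ p ∂P)
                / 2 ^ n) ^ (1 / p)

section Unconditional

variable {X : Type*} [NormedAddCommGroup X] [NormedSpace ℝ X]

theorem isMartDiffSeq_iff [CompleteSpace X] {Ω : Type*} {m : MeasurableSpace Ω} {ℱ : Filtration ℕ m}
    {P : Measure Ω} [IsFiniteMeasure P] {d : ℕ → Ω → X} :
    IsMartDiffSeq ℱ P d ↔ ∀ j, StronglyMeasurable[ℱ (j + 1)] (d j) ∧ Integrable (d j) P ∧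
      P[d j | ℱ j] =ᵐ[P] 0 := by
  have key (j : ℕ) : (fun ω => ∑ i ∈ Finset.range (j + 1), d i ω) -
      (fun ω => ∑ i ∈ Finset.range j, d i ω) = d j := by
    ext ω; simp [Finset.sum_range_succ]
  constructor
  · intro h j
    have hm := (h.1 (j + 1)).sub ((h.1 j).mono (ℱ.mono j.le_succ))
    have hi := (h.integrable (j + 1)).sub (h.integrable j)
    rw [key] at hm hi
    refine ⟨hm, hi, ?_⟩
    have := h.2 j (j + 1) j.le_succ
    have h3 := condExp_sub (h.integrable (j + 1)) (h.integrable j) (ℱ j)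
    have h4 := h.2 j j le_rfl
    rw [key] at h3
    filter_upwards [this, h3, h4] with ω h1 h2 h3
    rw [h2]; simp [h1, h3]
  · intro h
    refine martingale_of_condExp_sub_eq_zero_nat (fun n => ?_) (fun n => ?_) (fun n => ?_)
    · exact Finset.stronglyMeasurable_fun_sum _
        fun i hi => (h i).1.mono (ℱ.mono (by simpa using hi))
    · exact integrable_finsetSum _ fun i _ => (h i).2.1
    · rw [key]; exact (h n).2.2

/-- A martingale difference sequence restricted at each time to an event known in advance is again
a martingale difference sequence. -/
theorem IsMartDiffSeq.indicator [CompleteSpace X] {Ω : Type*} {m : MeasurableSpace Ω}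
    {ℱ : Filtration ℕ m}
    {P : Measure Ω} [IsFiniteMeasure P] {d : ℕ → Ω → X} (hd : IsMartDiffSeq ℱ P d)
    {A : ℕ → Set Ω} (hA : ∀ j, MeasurableSet[ℱ j] (A j)) :
    IsMartDiffSeq ℱ P fun j => (A j).indicator (d j) := by
  rw [isMartDiffSeq_iff] at hd ⊢
  intro j
  obtain ⟨h1, h2, h3⟩ := hd j
  refine ⟨h1.indicator (ℱ.mono j.le_succ _ (hA j)), h2.indicator (ℱ.le j _ (hA j)), ?_⟩
  refine (condExp_indicator h2 (hA j)).trans ?_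
  filter_upwards [h3] with ω hω
  by_cases h : ω ∈ A j <;> simp [h, hω]

/-- A seminorm on `X ^ N` which is invariant under changes of sign and restricts to the norm of `X`
on each coordinate. -/
structure IsUncond {N : ℕ} (S : Seminorm ℝ (Fin N → X)) : Prop where
  flip : ∀ (i : Fin N) (x : Fin N → X), S (Function.update x i (-x i)) = S x
  single : ∀ (i : Fin N) (v : X), S (Pi.single i v) = ‖v‖

namespace IsUncond

variable {N : ℕ} {S : Seminorm ℝ (Fin N → X)}

theorem update_smul_le (hS : IsUncond S) (i : Fin N) (x : Fin N → X) {c : ℝ} (hc : |c| ≤ 1) :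
    S (Function.update x i (c • x i)) ≤ S x := by
  have h : Function.update x i (c • x i) =
      ((1 + c) / 2) • x + ((1 - c) / 2) • Function.update x i (-x i) := by
    ext j
    by_cases hj : j = i
    · subst hj
      simp only [Function.update_self, Pi.add_apply, Pi.smul_apply]
      module
    · simp only [Function.update_of_ne hj, Pi.add_apply, Pi.smul_apply]
      module
  rw [abs_le] at hc
  rw [h]
  refine (map_add_le_add S _ _).trans ?_
  rw [map_smul_eq_mul, map_smul_eq_mul, hS.flip, Real.norm_of_nonneg (by linarith),
    Real.norm_of_nonneg (by linarith)]
  linarith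

theorem smul_le (hS : IsUncond S) (x : Fin N → X) {c : Fin N → ℝ} (hc : ∀ i, |c i| ≤ 1) :
    S (fun i => c i • x i) ≤ S x := by
  have key : ∀ s : Finset (Fin N), S (fun i => if i ∈ s then c i • x i else x i) ≤ S x := by
    intro s
    induction s using Finset.induction_on with
    | empty => simp
    | insert a s ha ih =>
      refine le_trans (le_of_eq ?_) ((hS.update_smul_le a _ (hc a)).trans ih)
      congr 1
      ext j
      by_cases hj : j = a
      · subst hj; simp [ha]
      · simp [hj]
  simpa using key Finset.univ

theorem ite_le (hS : IsUncond S) (x : Fin N → X) (A : Fin N → Prop)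
    [DecidablePred A] : S (fun i => if A i then x i else 0) ≤ S x := by
  refine le_trans (le_of_eq ?_) (hS.smul_le x (c := fun i => if A i then 1 else 0) ?_)
  · congr 1; ext i; split_ifs <;> simp
  · intro i; split_ifs <;> simp

theorem mono_ite (hS : IsUncond S) (x : Fin N → X) {A B : Fin N → Prop}
    [DecidablePred A] [DecidablePred B] (h : ∀ i, A i → B i) :
    S (fun i => if A i then x i else 0) ≤ S (fun i => if B i then x i else 0) := by
  refine le_trans (le_of_eq ?_) (hS.ite_le _ A)
  congr 1; ext i
  by_cases hi : A i
  · simp [hi, h i hi]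
  · simp [hi]

theorem norm_le (hS : IsUncond S) (x : Fin N → X) (i : Fin N) : ‖x i‖ ≤ S x := by
  rw [← hS.single i (x i)]
  refine le_trans (le_of_eq ?_) (hS.ite_le x (· = i))
  congr 1; ext j
  by_cases hj : j = i
  · subst hj; simp
  · simp [hj]

theorem le_sum (hS : IsUncond S) (x : Fin N → X) : S x ≤ ∑ i, ‖x i‖ := by
  conv_lhs => rw [← Finset.univ_sum_single x]
  refine (Finset.le_sum_of_subadditive S (map_zero S).le (map_add_le_add S) _ _).trans (le_of_eq ?_)
  simp [hS.single]

theorem continuous (hS : IsUncond S) : Continuous S := by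
  refine (LipschitzWith.of_dist_le_mul (K := (N : ℝ≥0)) fun x y => ?_).continuous
  rw [Real.dist_eq]
  refine (abs_sub_map_le_sub S x y).trans ((hS.le_sum _).trans ?_)
  refine (Finset.sum_le_card_nsmul _ _ (dist x y) fun i _ => ?_).trans (by simp)
  rw [Pi.sub_apply, ← dist_eq_norm]
  exact dist_le_pi_dist x y i

theorem measurable {Ω : Type*} {m : MeasurableSpace Ω} (hS : IsUncond S) {d : Fin N → Ω → X}
    (hd : ∀ i, StronglyMeasurable (d i)) : Measurable fun ω => S fun i => d i ω := by
  have h : StronglyMeasurable fun ω => ∑ i, (Pi.single i (d i ω) : Fin N → X) :=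
    Finset.stronglyMeasurable_fun_sum _
      fun i _ => (continuous_single i).comp_stronglyMeasurable (hd i)
  simp only [Finset.univ_sum_single] at h
  exact (hS.continuous.comp_stronglyMeasurable h).measurable

end IsUncond

end Unconditional

section GoodLambda

section

variable {X : Type*} [NormedAddCommGroup X]

/-- The maximum of the norms of the first `n` partial sums of a sequence. -/
def maxPartialSum (x : ℕ → X) (n : ℕ) : ℝ≥0 :=
  (Finset.range (n + 1)).sup fun k => ‖∑ i ∈ Finset.range k, x i‖₊

theorem maxPartialSum_mono (x : ℕ → X) : Monotone (maxPartialSum x) := fun _ _ h =>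
  Finset.sup_mono (Finset.range_mono (by lia))

theorem norm_le_maxPartialSum (x : ℕ → X) {k n : ℕ} (h : k ≤ n) :
    ‖∑ i ∈ Finset.range k, x i‖ ≤ maxPartialSum x n := by
  rw [← coe_nnnorm, NNReal.coe_le_coe]
  exact Finset.le_sup (f := fun k => ‖∑ i ∈ Finset.range k, x i‖₊) (by simp; lia)

theorem lt_maxPartialSum_iff (x : ℕ → X) {n : ℕ} {a : ℝ} (ha : 0 ≤ a) :
    a < maxPartialSum x n ↔ ∃ k ≤ n, a < ‖∑ i ∈ Finset.range k, x i‖ := by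
  lift a to ℝ≥0 using ha
  simp_rw [← coe_nnnorm, NNReal.coe_lt_coe, maxPartialSum, Finset.lt_sup_iff, Finset.mem_range,
    Nat.lt_succ_iff]

theorem measurable_maxPartialSum {Ω : Type*} {m : MeasurableSpace Ω} {d : ℕ → Ω → X} {n : ℕ}
    (hd : ∀ i < n, StronglyMeasurable (d i)) :
    Measurable fun ω => maxPartialSum (fun i => d i ω) n := by
  have h : ∀ k ≤ n, Measurable fun ω => ‖∑ i ∈ Finset.range k, d i ω‖₊ := fun k hk =>
    (Finset.stronglyMeasurable_fun_sum _
      fun i hi => hd i ((Finset.mem_range.1 hi).trans_le hk)).nnnorm.measurable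
  simpa only [maxPartialSum, Finset.sup'_eq_sup] using Finset.measurable_range_sup'' h

theorem maxPartialSum_le_sum (x : ℕ → X) (n : ℕ) :
    (maxPartialSum x n : ℝ) ≤ ∑ i ∈ Finset.range n, ‖x i‖ := by
  by_contra! h
  obtain ⟨k, hk, h⟩ := (lt_maxPartialSum_iff x (by positivity)).1 h
  refine absurd h (not_lt.2 ((norm_sum_le _ _).trans ?_))
  exact Finset.sum_le_sum_of_subset_of_nonneg (Finset.range_mono hk) fun _ _ _ => norm_nonneg _

theorem maxPartialSum_add_le (x y : ℕ → X) (n : ℕ) :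
    (maxPartialSum (x + y) n : ℝ) ≤ maxPartialSum x n + ∑ i ∈ Finset.range n, ‖y i‖ := by
  by_contra! h
  obtain ⟨k, hk, h⟩ := (lt_maxPartialSum_iff _ (by positivity)).1 h
  refine absurd h (not_lt.2 ?_)
  simp only [Pi.add_apply, Finset.sum_add_distrib]
  exact (norm_add_le _ _).trans (add_le_add (norm_le_maxPartialSum x hk)
    ((norm_le_maxPartialSum y hk).trans (maxPartialSum_le_sum y n)))

/-- If the partial sums of `x` exceed `b` in norm before time `N`, then the increments at the times
when their running maximum is in `(a, b]` add up to a vector of norm at least `b - a - c`. -/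
theorem le_norm_sum_ite_maxPartialSum (x : ℕ → X) {N : ℕ} {a b c : ℝ} (ha : 0 ≤ a) (hab : a ≤ b)
    (hx : ∀ j < N, ‖x j‖ ≤ c) (hN : b < maxPartialSum x N) :
    b - a - c ≤ ‖∑ j ∈ Finset.range N,
      if a < maxPartialSum x j ∧ maxPartialSum x j ≤ b then x j else 0‖ := by
  have hb : ∃ n, b < maxPartialSum x n := ⟨N, hN⟩
  have ha' : ∃ n, a < maxPartialSum x n := ⟨N, hab.trans_lt hN⟩
  set ν := Nat.find hb
  set μ := Nat.find ha'
  have hνN : ν ≤ N := Nat.find_min' hb hN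
  have hμν : μ ≤ ν := Nat.find_mono fun n h => hab.trans_lt h
  have hμ0 : μ ≠ 0 := by
    intro h
    have := Nat.find_spec ha'
    rw [show Nat.find ha' = 0 from h] at this
    simp [maxPartialSum] at this
    linarith
  have h1 : ∀ j, a < maxPartialSum x j ↔ μ ≤ j := fun j =>
    ⟨fun h => Nat.find_min' ha' h, fun h => (Nat.find_spec ha').trans_le
      (NNReal.coe_le_coe.2 (maxPartialSum_mono x h))⟩
  have h2 : ∀ j, b < maxPartialSum x j ↔ ν ≤ j := fun j =>
    ⟨fun h => Nat.find_min' hb h, fun h => (Nat.find_spec hb).trans_le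
      (NNReal.coe_le_coe.2 (maxPartialSum_mono x h))⟩
  have hsum : (∑ j ∈ Finset.range N,
      if a < maxPartialSum x j ∧ maxPartialSum x j ≤ b then x j else 0) =
      ∑ j ∈ Finset.range ν, x j - ∑ j ∈ Finset.range μ, x j := by
    rw [← Finset.sum_Ico_eq_sub _ hμν, ← Finset.sum_filter]
    refine Finset.sum_congr ?_ fun _ _ => rfl
    ext j
    have h3 : maxPartialSum x j ≤ b ↔ j < ν := by rw [← not_lt, h2, not_le]
    simp only [Finset.mem_filter, Finset.mem_range, Finset.mem_Ico, h1, h3]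
    exact ⟨fun h => h.2, fun h => ⟨h.2.trans_le hνN, h⟩⟩
  rw [hsum]
  have hν : b < ‖∑ j ∈ Finset.range ν, x j‖ := by
    obtain ⟨k, hk, h⟩ := (lt_maxPartialSum_iff x (ha.trans hab)).1 (Nat.find_spec hb)
    have : ν ≤ k := (h2 k).1 (h.trans_le (norm_le_maxPartialSum x le_rfl))
    rwa [le_antisymm this hk]
  have hμ : ‖∑ j ∈ Finset.range μ, x j‖ ≤ a + c := by
    obtain ⟨k, hk⟩ := Nat.exists_eq_succ_of_ne_zero hμ0
    rw [hk, Finset.sum_range_succ]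
    refine (norm_add_le _ _).trans (add_le_add ?_ (hx k (by lia)))
    refine (norm_le_maxPartialSum x le_rfl).trans (not_lt.1 ?_)
    rw [h1]; lia
  have := norm_sub_norm_le (∑ j ∈ Finset.range ν, x j) (∑ j ∈ Finset.range μ, x j)
  linarith

end

variable {X : Type*} [NormedAddCommGroup X] [NormedSpace ℝ X]

namespace IsUncond

variable {N : ℕ} {S : Seminorm ℝ (Fin N → X)}

theorem ite_le_two_mul (hS : IsUncond S) (x : ℕ → X) {Θ : Set ℕ} {c : ℝ} (hc : 0 ≤ c)
    (h : ∀ j ∈ Θ, j < N → S (fun i => if (i : ℕ) < j then x i else 0) ≤ c ∧ ‖x j‖ ≤ c) :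
    S (fun i => if (i : ℕ) ∈ Θ then x i else 0) ≤ 2 * c := by
  by_cases hne : ((Finset.range N).filter (· ∈ Θ)).Nonempty
  · obtain ⟨j, hj, hmax⟩ := Finset.exists_max_image _ id hne
    simp only [Finset.mem_filter, Finset.mem_range, id] at hj hmax
    obtain ⟨hS1, hx1⟩ := h j hj.2 hj.1
    have h1 : S (fun i => if (i : ℕ) ∈ Θ then x i else 0) ≤
        S (fun i => if (i : ℕ) ≤ j then x i else 0) :=
      hS.mono_ite (fun i => x i)
        fun i hi => hmax i ⟨i.2, hi⟩
    have h2 : (fun i : Fin N => if (i : ℕ) ≤ j then x i else 0) =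
        (fun i : Fin N => if (i : ℕ) < j then x i else 0) + Pi.single ⟨j, hj.1⟩ (x j) := by
      ext i
      rcases lt_trichotomy (i : ℕ) j with hij | hij | hij
      · have : i ≠ ⟨j, hj.1⟩ := fun h => by simp [h] at hij
        simp [hij, hij.le, this]
      · obtain rfl : i = ⟨j, hj.1⟩ := Fin.ext hij
        simp
      · have : i ≠ ⟨j, hj.1⟩ := fun h => by simp [h] at hij
        simp [hij.not_ge, hij.not_gt, this]
    rw [h2] at h1
    have h3 := map_add_le_add S (fun i : Fin N => if (i : ℕ) < j then x i else 0)
      (Pi.single ⟨j, hj.1⟩ (x j))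
    rw [hS.single] at h3
    linarith
  · rw [Finset.not_nonempty_iff_eq_empty] at hne
    have : (fun i : Fin N => if (i : ℕ) ∈ Θ then x i else 0) = 0 := by
      ext i
      have hi := Finset.eq_empty_iff_forall_notMem.1 hne i
      simp only [Finset.mem_filter, Finset.mem_range, i.2, true_and] at hi
      simp [hi]
    rw [this, map_zero]
    positivity

end IsUncond

/-- The `p`-th moment of a martingale at time `N` is controlled by that of the seminorm `S` of its
difference sequence. -/
def MomentBound [CompleteSpace X] {N : ℕ} (S : Seminorm ℝ (Fin N → X)) (p : ℝ) (C : ℝ≥0) : Prop :=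
  ∀ (Ω : Type) (m : MeasurableSpace Ω) (P : Measure Ω), IsProbabilityMeasure P →
    ∀ (ℱ : Filtration ℕ m) (d : ℕ → Ω → X), IsMartDiffSeq ℱ P d →
      ∫⁻ ω, ‖∑ j ∈ Finset.range N, d j ω‖ₑ ^ p ∂P ≤
        C * ∫⁻ ω, ENNReal.ofReal (S fun i => d i ω) ^ p ∂P

theorem MomentBound.good_lambda [CompleteSpace X] {N : ℕ} {S : Seminorm ℝ (Fin N → X)} {p : ℝ}
    (hp : 0 < p) {C : ℝ≥0} (hC : MomentBound S p C) (hS : IsUncond S)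
    {Ω : Type} {m : MeasurableSpace Ω}
    {P : Measure Ω} [IsProbabilityMeasure P] {ℱ : Filtration ℕ m} {d : ℕ → Ω → X}
    (hd : IsMartDiffSeq ℱ P d) {w : ℕ → Ω → ℝ} (hwm : ∀ j, Measurable[ℱ j] (w j))
    (hmono : ∀ ω, Monotone fun j => w j ω) (hw : ∀ j, ∀ᵐ ω ∂P, ‖d j ω‖ ≤ w j ω)
    {δ t : ℝ} (hδ : 0 < δ) (hδ1 : δ ≤ 1) (ht : 0 < t) :
    P {ω | 3 * t < maxPartialSum (fun i => d i ω) N ∧ S (fun i => d i ω) ≤ δ * t ∧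
        w N ω ≤ δ * t} ≤
      C * ENNReal.ofReal (2 * δ) ^ p * P {ω | t < maxPartialSum (fun i => d i ω) N} := by
  have hsm : ∀ i, StronglyMeasurable[ℱ (i + 1)] (d i) := fun i => ((isMartDiffSeq_iff.1 hd) i).1
  have hsmℱ : ∀ {i j}, i < j → StronglyMeasurable[ℱ j] (d i) :=
    fun {i j} h => (hsm i).mono (ℱ.mono h)
  have hsm' : ∀ i, StronglyMeasurable (d i) := fun i => (hsm i).mono (ℱ.le _)
  let M : ℕ → Ω → ℝ := fun n ω => maxPartialSum (fun i => d i ω) n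
  let T : ℕ → Ω → ℝ := fun j ω => S fun i => if (i : ℕ) < j then d i ω else 0
  have hMm : ∀ n, Measurable[ℱ n] (M n) := fun n =>
    measurable_subtype_coe.comp (measurable_maxPartialSum (m := ℱ n) fun i hi => hsmℱ hi)
  have hTm : ∀ n, Measurable[ℱ n] (T n) := fun n => by
    refine hS.measurable (m := ℱ n) (d := fun i ω => if (i : ℕ) < n then d i ω else 0) fun i => ?_
    by_cases hi : (i : ℕ) < n
    · simpa [hi] using hsmℱ hi
    · simpa [hi] using stronglyMeasurable_const
  let Θ : ℕ → Set Ω := fun j => {ω | (t < M j ω ∧ M j ω ≤ 3 * t) ∧ T j ω ≤ δ * t ∧ w j ω ≤ δ * t}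
  have hΘ : ∀ j, MeasurableSet[ℱ j] (Θ j) := fun j =>
    (((measurableSet_lt (mδ := ℱ j) measurable_const (hMm j)).inter
      (measurableSet_le (mδ := ℱ j) (hMm j) measurable_const)).inter
      ((measurableSet_le (mδ := ℱ j) (hTm j) measurable_const).inter
      (measurableSet_le (mδ := ℱ j) (hwm j) measurable_const)))
  have hMN : Measurable (M N) := (hMm N).mono (ℱ.le N) le_rfl
  have hTS : ∀ j ω, T j ω ≤ S fun i => d i ω := fun j ω =>
    hS.ite_le (fun i => d i ω) fun i => (i : ℕ) < j
  have hw' : ∀ᵐ ω ∂P, ∀ j, ‖d j ω‖ ≤ w j ω := ae_all_iff.2 hw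
  have main := hC Ω m P inferInstance ℱ _ (hd.indicator hΘ)
  have hupper : ∫⁻ ω, ENNReal.ofReal (S fun i => (Θ i).indicator (d i) ω) ^ p ∂P ≤
      ENNReal.ofReal (2 * δ * t) ^ p * P {ω | t < M N ω} := by
    rw [← lintegral_indicator_const (measurableSet_lt measurable_const hMN)]
    refine lintegral_mono_ae ?_
    filter_upwards [hw'] with ω hω
    by_cases hMt : t < M N ω
    · rw [Set.indicator_of_mem (by exact hMt)]
      refine ENNReal.rpow_le_rpow (ENNReal.ofReal_le_ofReal ?_) hp.le
      rw [mul_assoc]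
      exact hS.ite_le_two_mul (fun i => d i ω) (Θ := {j | ω ∈ Θ j}) (by positivity)
        fun j hj _ => ⟨hj.2.1, (hω j).trans hj.2.2⟩
    · have : (fun i : Fin N => (Θ i).indicator (d i) ω) = 0 := by
        ext i
        refine Set.indicator_of_notMem (fun h => hMt (h.1.1.trans_le ?_)) _
        exact NNReal.coe_le_coe.2 (maxPartialSum_mono _ i.2.le)
      simp [this, hp]
  have hlower : ENNReal.ofReal t ^ p * P {ω | 3 * t < M N ω ∧ S (fun i => d i ω) ≤ δ * t ∧
      w N ω ≤ δ * t} ≤ ∫⁻ ω, ‖∑ j ∈ Finset.range N, (Θ j).indicator (d j) ω‖ₑ ^ p ∂P := by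
    have hms : MeasurableSet {ω | 3 * t < M N ω ∧ S (fun i => d i ω) ≤ δ * t ∧ w N ω ≤ δ * t} :=
      (measurableSet_lt measurable_const hMN).inter
        ((measurableSet_le (hS.measurable fun i => hsm' i) measurable_const).inter
        (measurableSet_le ((hwm N).mono (ℱ.le N) le_rfl) measurable_const))
    rw [← lintegral_indicator_const hms]
    refine lintegral_mono_ae ?_
    filter_upwards [hw'] with ω hω
    refine Set.indicator_apply_le' (fun hmem => ?_) fun _ => zero_le
    obtain ⟨h3, hSω, hwω⟩ := hmem
    refine ENNReal.rpow_le_rpow ?_ hp.le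
    rw [← ofReal_norm]
    refine ENNReal.ofReal_le_ofReal ?_
    have hle : ∀ j < N, w j ω ≤ δ * t := fun j hj => (hmono ω hj.le).trans hwω
    have := le_norm_sum_ite_maxPartialSum (fun i => d i ω) (b := 3 * t) (c := δ * t) ht.le
      (by linarith) (fun j hj => (hω j).trans (hle j hj)) h3
    refine le_trans (by nlinarith) (this.trans (le_of_eq ?_))
    congr 1
    refine Finset.sum_congr rfl fun j hj => ?_
    rw [Set.indicator_apply]
    have hj' := Finset.mem_range.1 hj
    have : ω ∈ Θ j ↔ t < M j ω ∧ M j ω ≤ 3 * t :=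
      ⟨fun h => h.1, fun h => ⟨h, (hTS j ω).trans hSω, hle j hj'⟩⟩
    simp only [this, M]
  have h := hlower.trans (main.trans (mul_le_mul_right hupper _))
  have ht0 : ENNReal.ofReal t ^ p ≠ 0 := by simp [ht, ENNReal.rpow_eq_zero_iff]
  have htt : ENNReal.ofReal t ^ p ≠ ∞ := by simp [ENNReal.rpow_eq_top_iff, hp.not_gt]
  rw [ENNReal.ofReal_mul (by positivity), ENNReal.mul_rpow_of_nonneg _ _ hp.le] at h
  refine (ENNReal.mul_le_mul_iff_right ht0 htt).1 (h.trans (le_of_eq ?_))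
  ring

end GoodLambda

section Layercake

variable {Ω : Type*} {m : MeasurableSpace Ω} {μ : Measure Ω}

theorem lintegral_ofReal_rpow_const_mul {f : Ω → ℝ} {c q : ℝ} (hc : 0 ≤ c) (hq : 0 ≤ q) :
    ∫⁻ ω, ENNReal.ofReal (c * f ω) ^ q ∂μ =
      ENNReal.ofReal c ^ q * ∫⁻ ω, ENNReal.ofReal (f ω) ^ q ∂μ := by
  simp_rw [ENNReal.ofReal_mul hc, ENNReal.mul_rpow_of_nonneg _ _ hq]
  exact lintegral_const_mul' _ _ (ENNReal.rpow_ne_top_of_nonneg hq ENNReal.ofReal_ne_top)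

theorem lintegral_ofReal_rpow_add_le {f g : Ω → ℝ} {q : ℝ} (hq : 0 ≤ q)
    (hf : Measurable f) :
    ∫⁻ ω, ENNReal.ofReal (f ω + g ω) ^ q ∂μ ≤
      2 ^ q * (∫⁻ ω, ENNReal.ofReal (f ω) ^ q ∂μ + ∫⁻ ω, ENNReal.ofReal (g ω) ^ q ∂μ) := by
  rw [← lintegral_add_left (by fun_prop),
    ← lintegral_const_mul' _ _ (ENNReal.rpow_ne_top_of_nonneg hq ENNReal.ofNat_ne_top)]
  refine lintegral_mono fun ω => ?_
  have h : ENNReal.ofReal (f ω + g ω) ≤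
      2 * max (ENNReal.ofReal (f ω)) (ENNReal.ofReal (g ω)) := by
    rw [two_mul]
    exact ENNReal.ofReal_add_le.trans (add_le_add (le_max_left _ _) (le_max_right _ _))
  refine (ENNReal.rpow_le_rpow h hq).trans ?_
  rw [ENNReal.mul_rpow_of_nonneg _ _ hq]
  gcongr
  rcases le_total (ENNReal.ofReal (f ω)) (ENNReal.ofReal (g ω)) with h | h
  · rw [max_eq_right h]; exact le_add_self
  · rw [max_eq_left h]; exact le_self_add

theorem lintegral_ofReal_rpow_le_of_good_lambda [SFinite μ] {f g h : Ω → ℝ} (hf : Measurable f)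
    (hg : Measurable g) (hh : Measurable h) (hf0 : ∀ ω, 0 ≤ f ω) (hg0 : ∀ ω, 0 ≤ g ω)
    (hh0 : ∀ ω, 0 ≤ h ω) {q δ : ℝ} (hq : 0 < q) (hδ : 0 < δ) {ε : ℝ≥0∞}
    (hε : 3 ^ q * ε ≤ 2⁻¹) (hfin : ∫⁻ ω, ENNReal.ofReal (f ω) ^ q ∂μ ≠ ∞)
    (hgl : ∀ t, 0 < t → μ {ω | 3 * t < f ω ∧ g ω ≤ δ * t ∧ h ω ≤ δ * t} ≤ ε * μ {ω | t < f ω}) :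
    ∫⁻ ω, ENNReal.ofReal (f ω) ^ q ∂μ ≤ 2 * (3 ^ q * ENNReal.ofReal δ⁻¹ ^ q) *
      (∫⁻ ω, ENNReal.ofReal (g ω) ^ q ∂μ + ∫⁻ ω, ENNReal.ofReal (h ω) ^ q ∂μ) := by
  have cake : ∀ {F : Ω → ℝ}, Measurable F → (∀ ω, 0 ≤ F ω) →
      ∫⁻ ω, ENNReal.ofReal (F ω) ^ q ∂μ = ENNReal.ofReal q *
        ∫⁻ t in Set.Ioi 0, μ {ω | t < F ω} * ENNReal.ofReal (t ^ (q - 1)) := fun {F} hF hF0 => by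
    rw [← lintegral_rpow_eq_lintegral_meas_lt_mul μ (Eventually.of_forall hF0) hF.aemeasurable hq]
    simp_rw [ENNReal.ofReal_rpow_of_nonneg (hF0 _) hq.le]
  have hmeas : ∀ F : Ω → ℝ, Measurable fun t => μ {ω | t < F ω} * ENNReal.ofReal (t ^ (q - 1)) :=
    fun F => Measurable.mul (Antitone.measurable fun s t hst => measure_mono fun ω hω =>
      lt_of_le_of_lt hst hω) (by fun_prop)
  have hthird : ∫⁻ ω, ENNReal.ofReal (3⁻¹ * f ω) ^ q ∂μ ≤
      ε * ∫⁻ ω, ENNReal.ofReal (f ω) ^ q ∂μ +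
        (∫⁻ ω, ENNReal.ofReal (δ⁻¹ * g ω) ^ q ∂μ + ∫⁻ ω, ENNReal.ofReal (δ⁻¹ * h ω) ^ q ∂μ) := by
    rw [cake (hf.const_mul _) fun ω => by have := hf0 ω; positivity, cake hf hf0,
      cake (hg.const_mul _) fun ω => by have := hg0 ω; positivity,
      cake (hh.const_mul _) fun ω => by have := hh0 ω; positivity, mul_left_comm, ← mul_add,
      ← mul_add, ← lintegral_add_left (hmeas _), ← lintegral_const_mul ε (hmeas _),
      ← lintegral_add_left ((hmeas _).const_mul _)]
    refine mul_le_mul_right (setLIntegral_mono' measurableSet_Ioi fun t ht => ?_) _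
    rw [← add_mul, ← mul_assoc, ← add_mul]
    refine mul_le_mul_left ?_ _
    have hsub : {ω | t < 3⁻¹ * f ω} ⊆ {ω | 3 * t < f ω ∧ g ω ≤ δ * t ∧ h ω ≤ δ * t} ∪
        ({ω | t < δ⁻¹ * g ω} ∪ {ω | t < δ⁻¹ * h ω}) := by
      intro ω hω
      by_cases h1 : g ω ≤ δ * t
      · by_cases h2 : h ω ≤ δ * t
        · exact Or.inl ⟨by simp only [Set.mem_ofPred_eq] at hω; linarith, h1, h2⟩
        · right; right
          rw [Set.mem_ofPred_eq, lt_inv_mul_iff₀ hδ]; exact not_le.1 h2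
      · right; left
        rw [Set.mem_ofPred_eq, lt_inv_mul_iff₀ hδ]; exact not_le.1 h1
    refine (measure_mono hsub).trans ((measure_union_le _ _).trans ?_)
    exact add_le_add (hgl t ht) (measure_union_le _ _)
  rw [lintegral_ofReal_rpow_const_mul (by positivity) hq.le,
    lintegral_ofReal_rpow_const_mul (by positivity) hq.le,
    lintegral_ofReal_rpow_const_mul (by positivity) hq.le, ← mul_add] at hthird
  set F := ∫⁻ ω, ENNReal.ofReal (f ω) ^ q ∂μ
  set G := ∫⁻ ω, ENNReal.ofReal (g ω) ^ q ∂μ + ∫⁻ ω, ENNReal.ofReal (h ω) ^ q ∂μ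
  have h3 : (3 : ℝ≥0∞) ^ q * ENNReal.ofReal 3⁻¹ ^ q = 1 := by
    rw [← ENNReal.mul_rpow_of_nonneg _ _ hq.le, ENNReal.ofReal_inv_of_pos (by norm_num),
      ENNReal.ofReal_ofNat, ENNReal.mul_inv_cancel (by norm_num) (by norm_num), ENNReal.one_rpow]
  have h4 : F ≤ 2⁻¹ * F + 3 ^ q * ENNReal.ofReal δ⁻¹ ^ q * G := by
    calc F = 3 ^ q * (ENNReal.ofReal 3⁻¹ ^ q * F) := by rw [← mul_assoc, h3, one_mul]
      _ ≤ 3 ^ q * (ε * F + ENNReal.ofReal δ⁻¹ ^ q * G) := by gcongr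
      _ = (3 ^ q * ε) * F + 3 ^ q * ENNReal.ofReal δ⁻¹ ^ q * G := by ring
      _ ≤ _ := by gcongr
  have h5 : 2⁻¹ * F ≤ 3 ^ q * ENNReal.ofReal δ⁻¹ ^ q * G := by
    have hne : 2⁻¹ * F ≠ ∞ := ENNReal.mul_ne_top (by simp) hfin
    refine (ENNReal.add_le_add_iff_left hne).1 ?_
    rwa [← add_mul, ENNReal.inv_two_add_inv_two, one_mul]
  calc F = 2 * (2⁻¹ * F) := by
        rw [← mul_assoc, ENNReal.mul_inv_cancel (by norm_num) (by norm_num), one_mul]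
    _ ≤ _ := by rw [mul_assoc 2]; gcongr

end Layercake

section Weighted

variable {X : Type*} [NormedAddCommGroup X] [NormedSpace ℝ X]

theorem IsMartDiffSeq.stronglyMeasurable [CompleteSpace X] {Ω : Type*} {m : MeasurableSpace Ω}
    {ℱ : Filtration ℕ m} {P : Measure Ω} [IsFiniteMeasure P] {d : ℕ → Ω → X}
    (hd : IsMartDiffSeq ℱ P d) (j : ℕ) : StronglyMeasurable (d j) :=
  ((isMartDiffSeq_iff.1 hd j).1).mono (ℱ.le _)

theorem exists_pos_smallness {p q : ℝ} (hp : 0 < p) (C : ℝ≥0) :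
    ∃ δ : ℝ, 0 < δ ∧ δ ≤ 1 ∧ (3 : ℝ≥0∞) ^ q * (C * ENNReal.ofReal (2 * δ) ^ p) ≤ 2⁻¹ := by
  set a : ℝ := 1 / (2 * 3 ^ q * (C + 1)) with ha
  have ha0 : 0 < a := by positivity
  refine ⟨min 1 (a ^ (1 / p) / 2), by positivity, min_le_left _ _, ?_⟩
  have h1 : ENNReal.ofReal (2 * min 1 (a ^ (1 / p) / 2)) ^ p ≤ ENNReal.ofReal a := by
    calc _ ≤ ENNReal.ofReal (a ^ (1 / p)) ^ p := by
          gcongr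
          linarith [min_le_right 1 (a ^ (1 / p) / 2)]
      _ = ENNReal.ofReal a := by
          rw [ENNReal.ofReal_rpow_of_nonneg (by positivity) hp.le, ← Real.rpow_mul ha0.le,
            one_div_mul_cancel hp.ne', Real.rpow_one]
  have h3 : (3 : ℝ≥0∞) ^ q = ENNReal.ofReal (3 ^ q) := by
    rw [← ENNReal.ofReal_rpow_of_pos (by norm_num), ENNReal.ofReal_ofNat]
  have h2 : (2⁻¹ : ℝ≥0∞) = ENNReal.ofReal 2⁻¹ := by
    rw [ENNReal.ofReal_inv_of_pos (by norm_num), ENNReal.ofReal_ofNat]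
  calc _ ≤ (3 : ℝ≥0∞) ^ q * (C * ENNReal.ofReal a) := by gcongr
    _ ≤ 2⁻¹ := by
      rw [h3, h2, ← ENNReal.ofReal_coe_nnreal, ← ENNReal.ofReal_mul (by positivity),
        ← ENNReal.ofReal_mul (by positivity)]
      refine ENNReal.ofReal_le_ofReal ?_
      have h3q : (0 : ℝ) < 3 ^ q := by positivity
      have hC : (C : ℝ) / (C + 1) ≤ 1 := (div_le_one (by positivity)).2 (by linarith)
      calc (3 : ℝ) ^ q * (C * a) = 2⁻¹ * (C / (C + 1)) := by
            rw [ha]; field_simp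
        _ ≤ 2⁻¹ := by linarith

theorem exists_weighted_moment_bound [CompleteSpace X] {p q : ℝ} (hp : 0 < p) (hq : 0 < q)
    (C : ℝ≥0) :
    ∃ K : ℝ≥0, ∀ (N : ℕ) (S : Seminorm ℝ (Fin N → X)), MomentBound S p C → IsUncond S →
      ∀ (Ω : Type) (m : MeasurableSpace Ω) (P : Measure Ω), IsProbabilityMeasure P →
      ∀ (ℱ : Filtration ℕ m) (d : ℕ → Ω → X) (w : ℕ → Ω → ℝ), IsMartDiffSeq ℱ P d →
      (∀ j, Measurable[ℱ j] (w j)) → (∀ ω, Monotone fun j => w j ω) → (∀ j ω, 0 ≤ w j ω) →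
      (∀ j, ∀ᵐ ω ∂P, ‖d j ω‖ ≤ w j ω) →
      ∫⁻ ω, ENNReal.ofReal (maxPartialSum (fun i => d i ω) N) ^ q ∂P ≤
        K * (∫⁻ ω, ENNReal.ofReal (S fun i => d i ω) ^ q ∂P +
          ∫⁻ ω, ENNReal.ofReal (w N ω) ^ q ∂P) := by
  obtain ⟨δ, hδ, hδ1, hsmall⟩ := exists_pos_smallness (q := q) hp C
  have hKt : 2 * (3 ^ q * ENNReal.ofReal δ⁻¹ ^ q) ≠ ∞ := ENNReal.mul_ne_top (by simp)
    (ENNReal.mul_ne_top (ENNReal.rpow_ne_top_of_nonneg hq.le (by simp))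
      (ENNReal.rpow_ne_top_of_nonneg hq.le ENNReal.ofReal_ne_top))
  refine ⟨(2 * (3 ^ q * ENNReal.ofReal δ⁻¹ ^ q)).toNNReal + 1,
    fun N S hC hS Ω m P _ ℱ d w hd hwm hmono hw0 hw => ?_⟩
  by_cases hfin : ∫⁻ ω, ENNReal.ofReal (w N ω) ^ q ∂P = ∞
  · rw [hfin, add_top, ENNReal.mul_top (by simp)]
    exact le_top
  have hwN : ∀ᵐ ω ∂P, ∀ j, ‖d j ω‖ ≤ w j ω := ae_all_iff.2 hw
  have hmd : Measurable fun ω => ((maxPartialSum (fun i => d i ω) N : ℝ≥0) : ℝ) :=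
    (measurable_maxPartialSum fun i _ => hd.stronglyMeasurable i).coe_nnreal_real
  have hMfin : ∫⁻ ω, ENNReal.ofReal (maxPartialSum (fun i => d i ω) N) ^ q ∂P ≠ ∞ := by
    refine ne_top_of_le_ne_top (b := ∫⁻ ω, ENNReal.ofReal ((N : ℝ) * w N ω) ^ q ∂P) ?_ ?_
    · rw [lintegral_ofReal_rpow_const_mul (by positivity) hq.le]
      exact ENNReal.mul_ne_top (ENNReal.rpow_ne_top_of_nonneg hq.le ENNReal.ofReal_ne_top) hfin
    · refine lintegral_mono_ae ?_
      filter_upwards [hwN] with ω hω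
      gcongr
      refine (maxPartialSum_le_sum _ _).trans ((Finset.sum_le_card_nsmul _ _ (w N ω)
        fun i hi => (hω i).trans (hmono ω (Finset.mem_range.1 hi).le)).trans (by simp))
  refine (lintegral_ofReal_rpow_le_of_good_lambda hmd
    (hS.measurable fun i => hd.stronglyMeasurable i) ((hwm N).mono (ℱ.le N) le_rfl)
    (fun _ => by positivity) (fun _ => apply_nonneg S _) (hw0 N) hq hδ hsmall hMfin
    fun t ht => hC.good_lambda hp hS hd hwm hmono hw hδ hδ1 ht).trans ?_
  gcongr
  rw [ENNReal.coe_add, ENNReal.coe_toNNReal hKt]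
  exact le_self_add

end Weighted

section DualDoob

theorem rpow_sub_rpow_le {a b q : ℝ} (ha : 0 ≤ a) (hab : a ≤ b) (hq : 1 ≤ q) :
    b ^ q - a ^ q ≤ q * b ^ (q - 1) * (b - a) := by
  rcases (ha.trans hab).eq_or_lt with hb | hb
  · obtain rfl : a = b := le_antisymm hab (hb ▸ ha)
    simp
  have h := one_add_mul_self_le_rpow_one_add (s := a / b - 1) (by
    have := div_nonneg ha hb.le; linarith) hq
  rw [add_sub_cancel, Real.div_rpow ha hb.le, le_div_iff₀ (by positivity)] at h
  have hbq : b ^ q = b ^ (q - 1) * b := by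
    rw [← Real.rpow_add_one hb.ne']; ring_nf
  have : (1 + q * (a / b - 1)) * b ^ q = b ^ q - q * b ^ (q - 1) * (b - a) := by
    rw [hbq]; field_simp; ring
  linarith

theorem mul_rpow_sub_one_mul_le {a z q : ℝ} (ha : 0 ≤ a) (hz : 0 ≤ z) (hq : 1 ≤ q) :
    q * a ^ (q - 1) * z ≤ 2⁻¹ * a ^ q + q * (2 * q) ^ (q - 1) * z ^ q := by
  have hq0 : 0 < q := by linarith
  have hpow : ∀ x : ℝ, 0 ≤ x → x ^ q = x ^ (q - 1) * x := fun x hx => by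
    rcases hx.eq_or_lt with rfl | hx
    · simp [Real.zero_rpow hq0.ne']
    · rw [← Real.rpow_add_one hx.ne']; ring_nf
  rcases le_total a (2 * q * z) with h | h
  · have h1 : a ^ (q - 1) ≤ (2 * q * z) ^ (q - 1) := Real.rpow_le_rpow ha h (by linarith)
    rw [Real.mul_rpow (by positivity) hz] at h1
    calc q * a ^ (q - 1) * z ≤ q * ((2 * q) ^ (q - 1) * z ^ (q - 1)) * z := by gcongr
      _ = q * (2 * q) ^ (q - 1) * z ^ q := by rw [hpow z hz]; ring
      _ ≤ _ := le_add_of_nonneg_left (by positivity)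
  · calc q * a ^ (q - 1) * z = 2⁻¹ * (a ^ (q - 1) * (2 * q * z)) := by ring
      _ ≤ 2⁻¹ * (a ^ (q - 1) * a) := by gcongr
      _ = 2⁻¹ * a ^ q := by rw [hpow a ha]
      _ ≤ _ := le_add_of_nonneg_right (by positivity)

variable {Ω : Type*} {m : MeasurableSpace Ω} {P : Measure Ω} [IsProbabilityMeasure P]

theorem integral_mul_condExp_of_bound {m' : MeasurableSpace Ω} (hm : m' ≤ m) {f g : Ω → ℝ} {c : ℝ}
    (hf : StronglyMeasurable[m'] f) (hg : Integrable g P) (hc : ∀ ω, ‖f ω‖ ≤ c) :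
    ∫ ω, f ω * (P[g|m']) ω ∂P = ∫ ω, f ω * g ω ∂P := by
  have h := condExp_stronglyMeasurable_mul_of_bound hm hf hg c (Eventually.of_forall hc)
  calc _ = ∫ ω, (P[f * g|m']) ω ∂P := integral_congr_ae (h.mono fun ω hω => hω.symm)
    _ = _ := integral_condExp hm

theorem stronglyMeasurable_min_const {Ω' : Type*} {m' : MeasurableSpace Ω'} {f : Ω' → ℝ}
    (hf : StronglyMeasurable f) (L : ℝ) : StronglyMeasurable fun ω => min (f ω) L :=
  hf.inf stronglyMeasurable_const

theorem stronglyMeasurable_max_const {Ω' : Type*} {m' : MeasurableSpace Ω'} {f : Ω' → ℝ}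
    (hf : StronglyMeasurable f) (L : ℝ) : StronglyMeasurable fun ω => max (f ω) L :=
  hf.sup stronglyMeasurable_const

/-- The dual Doob inequality for truncated sums. -/
theorem lintegral_min_sum_condExp_rpow_le {ℱ : Filtration ℕ m} {z : ℕ → Ω → ℝ}
    (hz0 : ∀ j ω, 0 ≤ z j ω) (hzi : ∀ j, Integrable (z j) P) {c : ℕ → Ω → ℝ}
    (hc0 : ∀ j ω, 0 ≤ c j ω) (hcm : ∀ j, StronglyMeasurable[ℱ j] (c j))
    (hc : ∀ j, c j =ᵐ[P] P[z j|ℱ j]) {q : ℝ} (hq : 1 ≤ q) (N : ℕ) {L : ℝ} (hL : 0 ≤ L)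
    (hint : Integrable (fun ω => (∑ j ∈ Finset.range N, z j ω) ^ q) P) :
    ∫ ω, (min (∑ j ∈ Finset.range N, c j ω) L) ^ q ∂P ≤
      2 * (q * (2 * q) ^ (q - 1)) * ∫ ω, (∑ j ∈ Finset.range N, z j ω) ^ q ∂P := by
  set B : ℕ → Ω → ℝ := fun n ω => min (∑ j ∈ Finset.range n, c j ω) L with hB
  have hB0 : ∀ n ω, 0 ≤ B n ω := fun n ω => le_min (Finset.sum_nonneg fun j _ => hc0 j ω) hL
  have hBL : ∀ n ω, B n ω ≤ L := fun n ω => min_le_right _ _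
  have hBmono : ∀ ω, Monotone fun n => B n ω := fun ω => monotone_nat_of_le_succ fun n => by
    refine min_le_min_right _ ?_
    rw [Finset.sum_range_succ]
    linarith [hc0 n ω]
  have hBdiff : ∀ n ω, B (n + 1) ω - B n ω ≤ c n ω := fun n ω => by
    have := hc0 n ω
    simp only [hB, Finset.sum_range_succ]
    rcases le_total (∑ j ∈ Finset.range n, c j ω) L with h | h
    · rw [min_eq_left h]
      linarith [min_le_left (∑ j ∈ Finset.range n, c j ω + c n ω) L]
    · rw [min_eq_right h]
      linarith [min_le_right (∑ j ∈ Finset.range n, c j ω + c n ω) L]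
  have hBm : ∀ n, StronglyMeasurable[ℱ n] (B (n + 1)) := fun n => by
    refine stronglyMeasurable_min_const (Finset.stronglyMeasurable_fun_sum _ fun i hi => ?_) L
    exact (hcm i).mono (ℱ.mono (Nat.lt_succ_iff.1 (Finset.mem_range.1 hi)))
  have hBm' : ∀ n, StronglyMeasurable (B n) := fun n => by
    refine stronglyMeasurable_min_const (Finset.stronglyMeasurable_fun_sum _ fun i hi => ?_) L
    exact (hcm i).mono (ℱ.le i)
  have hpm : ∀ {m' : MeasurableSpace Ω} {f : Ω → ℝ} {r : ℝ}, StronglyMeasurable[m'] f →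
      StronglyMeasurable[m'] fun ω => f ω ^ r := fun {m'} {f} {r} hf =>
    (Measurable.pow_const hf.measurable r).stronglyMeasurable
  have hq1 : 0 ≤ q - 1 := by linarith
  have hbd : ∀ (r : ℝ), 0 ≤ r → ∀ n ω, ‖B n ω ^ r‖ ≤ L ^ r := fun r hr n ω => by
    rw [Real.norm_of_nonneg (Real.rpow_nonneg (hB0 n ω) _)]
    exact Real.rpow_le_rpow (hB0 n ω) (hBL n ω) hr
  have hBi : Integrable (fun ω => B N ω ^ q) P :=
    Integrable.of_bound (hpm (hBm' N)).aestronglyMeasurable _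
      (Eventually.of_forall (hbd q (by linarith) N))
  have hci : ∀ j, Integrable (c j) P := fun j => integrable_condExp.congr (hc j).symm
  have hBz : ∀ n (f : Ω → ℝ), Integrable f P → Integrable (fun ω => B n ω ^ (q - 1) * f ω) P :=
    fun n f hf => hf.bdd_mul (hpm (hBm' n)).aestronglyMeasurable
      (Eventually.of_forall (hbd _ hq1 n))
  have step1 : ∫ ω, B N ω ^ q ∂P ≤
      ∫ ω, ∑ j ∈ Finset.range N, q * (B (j + 1) ω ^ (q - 1) * c j ω) ∂P := by
    refine integral_mono hBi (integrable_finsetSum _ fun j _ => (hBz _ _ (hci j)).const_mul q)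
      fun ω => ?_
    have h0 : B 0 ω ^ q = 0 := by
      simp [hB, min_eq_left hL, Real.zero_rpow (by linarith : q ≠ 0)]
    calc B N ω ^ q = ∑ j ∈ Finset.range N, (B (j + 1) ω ^ q - B j ω ^ q) := by
          rw [Finset.sum_range_sub (fun j => B j ω ^ q), h0, sub_zero]
      _ ≤ _ := Finset.sum_le_sum fun j _ => by
          refine (rpow_sub_rpow_le (hB0 j ω) (hBmono ω (Nat.le_succ j)) hq).trans ?_
          rw [mul_assoc]
          have := Real.rpow_nonneg (hB0 (j + 1) ω) (q - 1)
          have := hBdiff j ω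
          gcongr
  have step2 : ∫ ω, ∑ j ∈ Finset.range N, q * (B (j + 1) ω ^ (q - 1) * c j ω) ∂P ≤
      ∫ ω, q * B N ω ^ (q - 1) * ∑ j ∈ Finset.range N, z j ω ∂P := by
    simp_rw [mul_assoc q, Finset.mul_sum]
    rw [integral_finsetSum _ fun j _ => (hBz _ _ (hci j)).const_mul q,
      integral_finsetSum _ fun j _ => (hBz _ _ (hzi j)).const_mul q]
    refine Finset.sum_le_sum fun j hj => ?_
    rw [integral_const_mul, integral_const_mul]
    gcongr q * ?_
    calc _ = ∫ ω, B (j + 1) ω ^ (q - 1) * (P[z j|ℱ j]) ω ∂P :=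
          integral_congr_ae ((hc j).mono fun ω hω => by simp only [hω])
      _ = ∫ ω, B (j + 1) ω ^ (q - 1) * z j ω ∂P :=
          integral_mul_condExp_of_bound (ℱ.le j) (hpm (hBm j)) (hzi j) (hbd _ hq1 _)
      _ ≤ _ := integral_mono (hBz _ _ (hzi j)) (hBz _ _ (hzi j)) fun ω =>
          mul_le_mul_of_nonneg_right (Real.rpow_le_rpow (hB0 _ _)
            (hBmono ω (Finset.mem_range.1 hj)) hq1) (hz0 j ω)
  have step3 : ∫ ω, q * B N ω ^ (q - 1) * ∑ j ∈ Finset.range N, z j ω ∂P ≤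
      2⁻¹ * ∫ ω, B N ω ^ q ∂P +
        q * (2 * q) ^ (q - 1) * ∫ ω, (∑ j ∈ Finset.range N, z j ω) ^ q ∂P := by
    rw [← integral_const_mul, ← integral_const_mul, ← integral_add (hBi.const_mul _)
      (hint.const_mul _)]
    refine integral_mono ?_ ((hBi.const_mul _).add (hint.const_mul _)) fun ω =>
      mul_rpow_sub_one_mul_le (hB0 N ω) (Finset.sum_nonneg fun j _ => hz0 j ω) hq
    simp_rw [mul_assoc q]
    exact (hBz _ _ (integrable_finsetSum _ fun j _ => hzi j)).const_mul q
  linarith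

theorem exists_lintegral_sum_condExp_rpow_le {q : ℝ} (hq : 1 ≤ q) :
    ∃ K : ℝ≥0, ∀ (Ω : Type) (m : MeasurableSpace Ω) (P : Measure Ω), IsProbabilityMeasure P →
      ∀ (ℱ : Filtration ℕ m) (z : ℕ → Ω → ℝ), (∀ j ω, 0 ≤ z j ω) → (∀ j, Integrable (z j) P) →
      (∀ j, Measurable (z j)) → ∀ N,
      ∫⁻ ω, ENNReal.ofReal (∑ j ∈ Finset.range N, (P[z j|ℱ j]) ω) ^ q ∂P ≤
        K * ∫⁻ ω, ENNReal.ofReal (∑ j ∈ Finset.range N, z j ω) ^ q ∂P := by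
  have hq0 : 0 < q := by linarith
  refine ⟨(2 * (q * (2 * q) ^ (q - 1))).toNNReal + 1, fun Ω m P _ ℱ z hz0 hzi hzm N => ?_⟩
  have hZ0 : ∀ ω, 0 ≤ ∑ j ∈ Finset.range N, z j ω := fun ω => Finset.sum_nonneg fun j _ => hz0 j ω
  by_cases hfin : ∫⁻ ω, ENNReal.ofReal (∑ j ∈ Finset.range N, z j ω) ^ q ∂P = ∞
  · rw [hfin, ENNReal.mul_top (by simp)]
    exact le_top
  simp_rw [ENNReal.ofReal_rpow_of_nonneg (hZ0 _) hq0.le] at hfin ⊢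
  have hint : Integrable (fun ω => (∑ j ∈ Finset.range N, z j ω) ^ q) P := by
    refine (lintegral_ofReal_ne_top_iff_integrable ?_ ?_).1 hfin
    · exact Measurable.aestronglyMeasurable (by fun_prop)
    · exact Eventually.of_forall fun ω => Real.rpow_nonneg (hZ0 ω) _
  set c : ℕ → Ω → ℝ := fun j ω => max ((P[z j|ℱ j]) ω) 0 with hcdef
  have hc0 : ∀ j ω, 0 ≤ c j ω := fun j ω => le_max_right _ _
  have hcm : ∀ j, StronglyMeasurable[ℱ j] (c j) := fun j =>
    stronglyMeasurable_max_const stronglyMeasurable_condExp 0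
  have hc : ∀ j, c j =ᵐ[P] P[z j|ℱ j] := fun j => by
    filter_upwards [condExp_nonneg (m := ℱ j) (Eventually.of_forall (hz0 j) : 0 ≤ᵐ[P] z j)]
      with ω hω
    exact max_eq_left hω
  have hcmm : ∀ j, Measurable (c j) := fun j => ((hcm j).mono (ℱ.le j)).measurable
  calc ∫⁻ ω, ENNReal.ofReal (∑ j ∈ Finset.range N, (P[z j|ℱ j]) ω) ^ q ∂P
      ≤ ∫⁻ ω, ⨆ L : ℕ, ENNReal.ofReal (min (∑ j ∈ Finset.range N, c j ω) L) ^ q ∂P := by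
        refine lintegral_mono fun ω => ?_
        obtain ⟨L, hL⟩ := exists_nat_ge (∑ j ∈ Finset.range N, c j ω)
        refine le_trans ?_ (le_iSup _ L)
        rw [min_eq_left hL]
        gcongr with j _
        exact le_max_left _ _
    _ = ⨆ L : ℕ, ∫⁻ ω, ENNReal.ofReal (min (∑ j ∈ Finset.range N, c j ω) L) ^ q ∂P := by
        refine lintegral_iSup (fun L => by fun_prop) fun L L' h ω => ?_
        dsimp only
        gcongr
    _ ≤ _ := iSup_le fun L => by
        have hB0 : ∀ ω, 0 ≤ min (∑ j ∈ Finset.range N, c j ω) (L : ℝ) := fun ω =>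
          le_min (Finset.sum_nonneg fun j _ => hc0 j ω) L.cast_nonneg
        simp_rw [ENNReal.ofReal_rpow_of_nonneg (hB0 _) hq0.le]
        rw [← ofReal_integral_eq_lintegral_ofReal ?_
          (Eventually.of_forall fun ω => Real.rpow_nonneg (hB0 ω) _),
          ← ofReal_integral_eq_lintegral_ofReal hint
            (Eventually.of_forall fun ω => Real.rpow_nonneg (hZ0 ω) _)]
        · refine (ENNReal.ofReal_le_ofReal (lintegral_min_sum_condExp_rpow_le hz0 hzi hc0 hcm hc hq N
            L.cast_nonneg hint)).trans ?_
          rw [ENNReal.ofReal_mul (by positivity)]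
          gcongr
          rw [ENNReal.coe_add]
          exact le_self_add
        · refine Integrable.of_bound (Measurable.aestronglyMeasurable (by fun_prop)) ((L : ℝ) ^ q)
            (Eventually.of_forall fun ω => ?_)
          rw [Real.norm_of_nonneg (Real.rpow_nonneg (hB0 ω) _)]
          exact Real.rpow_le_rpow (hB0 ω) (min_le_right _ _) hq0.le

end DualDoob

section Davis

variable {X : Type*} [NormedAddCommGroup X]

/-- The running maximum of the norms of the terms of a sequence. -/
def maxNorm (x : ℕ → X) (n : ℕ) : ℝ≥0 := (Finset.range n).sup fun i => ‖x i‖₊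

theorem maxNorm_mono (x : ℕ → X) : Monotone (maxNorm x) := fun _ _ h =>
  Finset.sup_mono (Finset.range_mono h)

theorem maxNorm_succ (x : ℕ → X) (n : ℕ) : maxNorm x (n + 1) = max ‖x n‖₊ (maxNorm x n) := by
  simp [maxNorm, Finset.range_add_one, Finset.sup_insert]

theorem measurable_maxNorm {Ω : Type*} {m : MeasurableSpace Ω} {d : ℕ → Ω → X} {n : ℕ}
    (hd : ∀ i < n, StronglyMeasurable (d i)) : Measurable fun ω => maxNorm (fun i => d i ω) n := by
  induction n with
  | zero => simp only [maxNorm, Finset.range_zero, Finset.sup_empty]; exact measurable_const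
  | succ n ih =>
    simp_rw [maxNorm_succ]
    exact (hd n (by lia)).nnnorm.measurable.max (ih fun i hi => hd i (by lia))

theorem sum_norm_large_jump_le (x : ℕ → X) (n : ℕ) :
    ∑ j ∈ Finset.range n, ‖if 2 * (maxNorm x j : ℝ) < ‖x j‖ then x j else 0‖ ≤
      2 * maxNorm x n := by
  induction n with
  | zero => simp
  | succ n ih =>
    rw [Finset.sum_range_succ, maxNorm_succ]
    push_cast
    split_ifs with h
    · linarith [le_max_left ‖x n‖ (maxNorm x n : ℝ)]
    · rw [norm_zero]
      linarith [le_max_right ‖x n‖ (maxNorm x n : ℝ)]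

variable [NormedSpace ℝ X]

theorem IsUncond.maxNorm_le {N : ℕ} {S : Seminorm ℝ (Fin N → X)} (hS : IsUncond S) (x : ℕ → X) :
    (maxNorm x N : ℝ) ≤ S fun i => x i := by
  rw [← NNReal.coe_mk (S fun i => x i) (apply_nonneg S _), NNReal.coe_le_coe]
  refine Finset.sup_le fun i hi => ?_
  rw [← NNReal.coe_le_coe]
  exact hS.norm_le (fun i => x i) ⟨i, Finset.mem_range.1 hi⟩

/-- Davis decomposition. -/
theorem IsMartDiffSeq.exists_davis [CompleteSpace X] {Ω : Type} {m : MeasurableSpace Ω}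
    {ℱ : Filtration ℕ m} {P : Measure Ω} [IsProbabilityMeasure P] {d : ℕ → Ω → X}
    (hd : IsMartDiffSeq ℱ P d) : ∃ (a b v : ℕ → Ω → X), d = a + b ∧ IsMartDiffSeq ℱ P a ∧
      (∀ j, ∀ᵐ ω ∂P, ‖a j ω‖ ≤ 4 * maxNorm (fun i => d i ω) j) ∧
      (∀ j, StronglyMeasurable (v j)) ∧ (∀ j, Integrable (v j) P) ∧
      (∀ j, ∀ᵐ ω ∂P, ‖b j ω‖ ≤ ‖v j ω‖ + (P[fun ω => ‖v j ω‖|ℱ j]) ω) ∧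
      ∀ n ω, ∑ j ∈ Finset.range n, ‖v j ω‖ ≤ 2 * maxNorm (fun i => d i ω) n := by
  have hd' := isMartDiffSeq_iff.1 hd
  set v : ℕ → Ω → X := fun j ω =>
    if 2 * (maxNorm (fun i => d i ω) j : ℝ) < ‖d j ω‖ then d j ω else 0 with hv
  have hDm : ∀ j, Measurable[ℱ j] fun ω => maxNorm (fun i => d i ω) j := fun j =>
    measurable_maxNorm fun i hi => (hd' i).1.mono (ℱ.mono hi)
  have hDi : ∀ j, Integrable (fun ω => (maxNorm (fun i => d i ω) j : ℝ)) P := fun j => by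
    refine Integrable.mono' (integrable_finsetSum (Finset.range j) fun i _ => (hd' i).2.1.norm)
      ((hDm j).mono (ℱ.le j) le_rfl).coe_nnreal_real.aestronglyMeasurable
      (Eventually.of_forall fun ω => ?_)
    rw [Real.norm_of_nonneg NNReal.zero_le_coe]
    have : maxNorm (fun i => d i ω) j ≤ ∑ i ∈ Finset.range j, ‖d i ω‖₊ :=
      Finset.sup_le fun i hi => Finset.single_le_sum (f := fun i => ‖d i ω‖₊)
        (fun _ _ => zero_le) hi
    simpa only [← NNReal.coe_le_coe, NNReal.coe_sum, coe_nnnorm] using this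
  have hAm : ∀ j, MeasurableSet[ℱ (j + 1)]
      {ω | 2 * (maxNorm (fun i => d i ω) j : ℝ) < ‖d j ω‖} := fun j =>
    measurableSet_lt (mδ := ℱ (j + 1))
      ((((hDm j).mono (ℱ.mono j.le_succ) le_rfl).coe_nnreal_real).const_mul 2)
      (hd' j).1.norm.measurable
  have hvm : ∀ j, StronglyMeasurable[ℱ (j + 1)] (v j) := fun j =>
    StronglyMeasurable.ite (hAm j) (hd' j).1 stronglyMeasurable_zero
  have hvd : ∀ j ω, ‖v j ω‖ ≤ ‖d j ω‖ := fun j ω => by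
    simp only [hv]; split_ifs <;> simp
  have hvi : ∀ j, Integrable (v j) P := fun j =>
    (hd' j).2.1.mono ((hvm j).mono (ℱ.le _)).aestronglyMeasurable (Eventually.of_forall (hvd j))
  have hui : ∀ j, Integrable (d j - v j) P := fun j => (hd' j).2.1.sub (hvi j)
  have hum : ∀ j, StronglyMeasurable[ℱ (j + 1)] (d j - v j) := fun j => (hd' j).1.sub (hvm j)
  have hu : ∀ j ω, ‖(d j - v j) ω‖ ≤ 2 * maxNorm (fun i => d i ω) j := fun j ω => by
    simp only [hv, Pi.sub_apply]
    split_ifs with h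
    · simp
    · simpa using h
  have hcm : ∀ j, StronglyMeasurable[ℱ j] (P[d j - v j|ℱ j]) := fun j => stronglyMeasurable_condExp
  refine ⟨fun j => d j - v j - P[d j - v j|ℱ j], fun j => v j + P[d j - v j|ℱ j], v, ?_, ?_,
    fun j => ?_, fun j => (hvm j).mono (ℱ.le _), hvi, fun j => ?_, fun n ω =>
      sum_norm_large_jump_le _ n⟩
  · ext j ω; simp
  · refine isMartDiffSeq_iff.2 fun j => ⟨(hum j).sub ((hcm j).mono (ℱ.mono j.le_succ)),
      (hui j).sub integrable_condExp, ?_⟩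
    refine (condExp_sub (hui j) integrable_condExp _).trans ?_
    rw [condExp_of_stronglyMeasurable (ℱ.le j) (hcm j) integrable_condExp, sub_self]
  · have h1 : ∀ᵐ ω ∂P, ‖(P[d j - v j|ℱ j]) ω‖ ≤ 2 * maxNorm (fun i => d i ω) j := by
      have h2 := condExp_mono (m := ℱ j) (hui j).norm ((hDi j).const_mul 2)
        (Eventually.of_forall (hu j))
      rw [condExp_of_stronglyMeasurable (ℱ.le j)
        ((hDm j).coe_nnreal_real.const_mul 2).stronglyMeasurable ((hDi j).const_mul 2)] at h2
      exact (norm_condExp_le (d j - v j)).trans h2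
    filter_upwards [h1] with ω hω
    refine (norm_sub_le _ _).trans ?_
    linarith [hu j ω]
  · have h1 : P[d j - v j|ℱ j] =ᵐ[P] -P[v j|ℱ j] := by
      filter_upwards [condExp_sub (hd' j).2.1 (hvi j) (ℱ j), (hd' j).2.2] with ω h1 h2
      simp [h1, h2]
    filter_upwards [h1, norm_condExp_le (μ := P) (m := ℱ j) (v j)] with ω h1 h2
    refine (norm_add_le _ _).trans ?_
    rw [h1, Pi.neg_apply, norm_neg]
    gcongr

theorem exists_maximal_moment_bound [CompleteSpace X] {p q : ℝ} (hp : 0 < p) (hq : 1 ≤ q)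
    (C : ℝ≥0) :
    ∃ K : ℝ≥0, ∀ (N : ℕ) (S : Seminorm ℝ (Fin N → X)), MomentBound S p C → IsUncond S →
      ∀ (Ω : Type) (m : MeasurableSpace Ω) (P : Measure Ω), IsProbabilityMeasure P →
      ∀ (ℱ : Filtration ℕ m) (d : ℕ → Ω → X), IsMartDiffSeq ℱ P d →
      ∫⁻ ω, ENNReal.ofReal (maxPartialSum (fun i => d i ω) N) ^ q ∂P ≤
        K * ∫⁻ ω, ENNReal.ofReal (S fun i => d i ω) ^ q ∂P := by
  have hq0 : 0 < q := by linarith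
  obtain ⟨K₁, hK₁⟩ := exists_weighted_moment_bound (X := X) hp hq0 C
  obtain ⟨K₂, hK₂⟩ := exists_lintegral_sum_condExp_rpow_le hq
  obtain ⟨c2, hc2⟩ : ∃ c : ℝ≥0, (c : ℝ≥0∞) = 2 ^ q :=
    ⟨2 ^ q, by rw [ENNReal.coe_rpow_of_nonneg _ hq0.le]; rfl⟩
  obtain ⟨c4, hc4⟩ : ∃ c : ℝ≥0, (c : ℝ≥0∞) = 4 ^ q :=
    ⟨4 ^ q, by rw [ENNReal.coe_rpow_of_nonneg _ hq0.le]; rfl⟩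
  set W : ℝ≥0 := c2 * (c2 + K₂ * c2) with hW
  refine ⟨c2 * (K₁ * (c2 * (1 + W) + c4) + W), fun N S hC hS Ω m P _ ℱ d hd => ?_⟩
  obtain ⟨a, b, v, hab, ha, ha4, hvm, hvi, hbv, hvD⟩ := hd.exists_davis
  set I := ∫⁻ ω, ENNReal.ofReal (S fun i => d i ω) ^ q ∂P with hI
  have hDI : ∫⁻ ω, ENNReal.ofReal (maxNorm (fun i => d i ω) N) ^ q ∂P ≤ I := by
    refine lintegral_mono fun ω => ?_
    gcongr
    exact hS.maxNorm_le _
  have hvI : ∫⁻ ω, ENNReal.ofReal (∑ j ∈ Finset.range N, ‖v j ω‖) ^ q ∂P ≤ c2 * I := by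
    calc _ ≤ ∫⁻ ω, ENNReal.ofReal (2 * maxNorm (fun i => d i ω) N) ^ q ∂P := by
          refine lintegral_mono fun ω => ?_
          gcongr
          exact hvD N ω
      _ ≤ c2 * I := by
          rw [lintegral_ofReal_rpow_const_mul (by norm_num) hq0.le, hc2, ENNReal.ofReal_ofNat]
          gcongr
  have hbI : ∫⁻ ω, ENNReal.ofReal (∑ j ∈ Finset.range N, ‖b j ω‖) ^ q ∂P ≤ W * I := by
    calc _ ≤ ∫⁻ ω, ENNReal.ofReal (∑ j ∈ Finset.range N, ‖v j ω‖ +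
            ∑ j ∈ Finset.range N, (P[fun ω => ‖v j ω‖|ℱ j]) ω) ^ q ∂P := by
          refine lintegral_mono_ae ?_
          filter_upwards [ae_all_iff.2 hbv] with ω hω
          rw [← Finset.sum_add_distrib]
          gcongr with j _
          exact hω j
      _ ≤ c2 * (c2 * I + K₂ * (c2 * I)) := by
          rw [hc2]
          refine (lintegral_ofReal_rpow_add_le hq0.le ?_).trans ?_
          · exact Finset.measurable_fun_sum _ fun j _ => (hvm j).norm.measurable
          · rw [← hc2]
            gcongr
            refine (hK₂ Ω m P inferInstance ℱ (fun j ω => ‖v j ω‖) (fun _ _ => norm_nonneg _)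
              (fun j => (hvi j).norm) (fun j => (hvm j).norm.measurable) N).trans ?_
            gcongr
      _ = W * I := by rw [hW]; push_cast; ring
  have haS : ∫⁻ ω, ENNReal.ofReal (S fun i => a i ω) ^ q ∂P ≤ c2 * (I + W * I) := by
    calc _ ≤ ∫⁻ ω, ENNReal.ofReal ((S fun i => d i ω) +
            ∑ j ∈ Finset.range N, ‖b j ω‖) ^ q ∂P := by
          refine lintegral_mono fun ω => ?_
          gcongr
          have h : (fun i : Fin N => a i ω) = (fun i : Fin N => d i ω) - fun i : Fin N => b i ω := by
            ext i; simp [hab]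
          rw [h]
          refine (map_sub_le_add S _ _).trans ?_
          gcongr
          refine (hS.le_sum _).trans (le_of_eq ?_)
          exact Fin.sum_univ_eq_sum_range (fun j => ‖b j ω‖) N
      _ ≤ _ := by
          rw [hc2]
          refine (lintegral_ofReal_rpow_add_le hq0.le
            (hS.measurable fun i => hd.stronglyMeasurable i)).trans ?_
          gcongr
  have hMa : ∫⁻ ω, ENNReal.ofReal (maxPartialSum (fun i => a i ω) N) ^ q ∂P ≤
      K₁ * (c2 * (I + W * I) + c4 * I) := by
    refine (hK₁ N S hC hS Ω m P inferInstance ℱ a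
      (fun j ω => 4 * (maxNorm (fun i => d i ω) j : ℝ)) ha (fun j => ?_) (fun ω i j hij => ?_)
      (fun j ω => by positivity) ha4).trans ?_
    · exact ((measurable_maxNorm fun i hi => ((isMartDiffSeq_iff.1 hd i).1.mono
        (ℱ.mono hi))).coe_nnreal_real).const_mul 4
    · have := maxNorm_mono (fun i => d i ω) hij
      dsimp only
      gcongr
    · rw [lintegral_ofReal_rpow_const_mul (by norm_num) hq0.le, hc4, ENNReal.ofReal_ofNat]
      gcongr
  calc ∫⁻ ω, ENNReal.ofReal (maxPartialSum (fun i => d i ω) N) ^ q ∂P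
      ≤ ∫⁻ ω, ENNReal.ofReal ((maxPartialSum (fun i => a i ω) N : ℝ) +
            ∑ j ∈ Finset.range N, ‖b j ω‖) ^ q ∂P := by
        refine lintegral_mono fun ω => ?_
        gcongr
        rw [show (fun i => d i ω) = (fun i => a i ω) + fun i => b i ω by ext i; simp [hab]]
        exact maxPartialSum_add_le _ _ N
    _ ≤ c2 * (K₁ * (c2 * (I + W * I) + c4 * I) + W * I) := by
        rw [hc2]
        refine (lintegral_ofReal_rpow_add_le hq0.le (measurable_maxPartialSum fun i _ =>
          ha.stronglyMeasurable i).coe_nnreal_real).trans ?_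
        rw [← hc2]
        gcongr
    _ = _ := by push_cast; ring

end Davis

section RandomSeminorm

variable {X : Type*} [NormedAddCommGroup X] [NormedSpace ℝ X]

/-- A finite family of normalized square integrable random variables whose joint law is invariant
under changing the sign of any one of them. -/
structure SymmSystem {Ω : Type*} [MeasurableSpace Ω] (μ : Measure Ω) {N : ℕ}
    (r : Fin N → Ω → ℝ) : Prop where
  measurable : ∀ i, Measurable (r i)
  eLpNorm_eq : ∀ i, eLpNorm (r i) 2 μ = 1
  flip : ∀ i, ∃ T : Ω → Ω, MeasurePreserving T μ μ ∧ (∀ ω, r i (T ω) = -r i ω) ∧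
    ∀ j, j ≠ i → ∀ ω, r j (T ω) = r j ω

namespace SymmSystem

variable {Ω : Type*} [MeasurableSpace Ω] {μ : Measure Ω} {N : ℕ} {r : Fin N → Ω → ℝ}

theorem stronglyMeasurable_sum (h : SymmSystem μ r) (x : Fin N → X) :
    StronglyMeasurable fun ω => ∑ i, r i ω • x i :=
  Finset.stronglyMeasurable_fun_sum _ fun i _ => (h.measurable i).stronglyMeasurable.smul_const _

theorem eLpNorm_smul_const (h : SymmSystem μ r) (i : Fin N) (v : X) :
    eLpNorm (fun ω => r i ω • v) 2 μ = ‖v‖ₑ := by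
  have : eLpNorm (fun ω => r i ω • v) 2 μ = eLpNorm (‖v‖ • r i) 2 μ :=
    eLpNorm_congr_norm_ae (Eventually.of_forall fun ω => by simp [norm_smul, mul_comm])
  rw [this, eLpNorm_const_smul, h.eLpNorm_eq i, mul_one, enorm_norm]

theorem memLp_sum (h : SymmSystem μ r) (x : Fin N → X) :
    MemLp (fun ω => ∑ i, r i ω • x i) 2 μ :=
  memLp_finsetSum _ fun i _ =>
    ⟨((h.measurable i).stronglyMeasurable.smul_const _).aestronglyMeasurable, by
      rw [h.eLpNorm_smul_const]; exact enorm_lt_top⟩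

/-- The seminorm `x ↦ (E‖∑ rᵢ xᵢ‖²)^{1/2}`. -/
def seminorm (h : SymmSystem μ r) : Seminorm ℝ (Fin N → X) :=
  Seminorm.of (fun x => (eLpNorm (fun ω => ∑ i, r i ω • x i) 2 μ).toReal)
    (fun x y => by
      rw [← ENNReal.toReal_add (h.memLp_sum x).2.ne (h.memLp_sum y).2.ne]
      refine ENNReal.toReal_mono (ENNReal.add_ne_top.2 ⟨(h.memLp_sum x).2.ne,
        (h.memLp_sum y).2.ne⟩) ?_
      refine le_trans (le_of_eq ?_) (eLpNorm_add_le (h.memLp_sum x).1 (h.memLp_sum y).1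
        one_le_two)
      congr 1; ext ω; simp [Finset.sum_add_distrib])
    (fun a x => by
      have : (fun ω => ∑ i, r i ω • (a • x) i) = a • fun ω => ∑ i, r i ω • x i := by
        ext ω; simp [Finset.smul_sum, smul_comm a]
      rw [this, eLpNorm_const_smul, ENNReal.toReal_mul, toReal_enorm])

theorem ofReal_seminorm (h : SymmSystem μ r) (x : Fin N → X) :
    ENNReal.ofReal (h.seminorm x) = eLpNorm (fun ω => ∑ i, r i ω • x i) 2 μ :=
  ENNReal.ofReal_toReal (h.memLp_sum x).2.ne

theorem eLpNorm_two_sq {F : Type*} [NormedAddCommGroup F] (f : Ω → F) :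
    eLpNorm f 2 μ ^ 2 = ∫⁻ ω, ‖f ω‖ₑ ^ 2 ∂μ := by
  have h := eLpNorm_nnreal_pow_eq_lintegral (μ := μ) (f := f) (p := 2) two_ne_zero
  simpa using h

theorem ofReal_seminorm_sq (h : SymmSystem μ r) (x : Fin N → X) :
    ENNReal.ofReal (h.seminorm x) ^ 2 = ∫⁻ ω, ‖∑ i, r i ω • x i‖ₑ ^ 2 ∂μ := by
  rw [h.ofReal_seminorm, eLpNorm_two_sq]

theorem eLpNorm_flip (h : SymmSystem μ r) (i : Fin N) (x : Fin N → X) :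
    eLpNorm (fun ω => ∑ j, r j ω • Function.update x i (-x i) j) 2 μ =
      eLpNorm (fun ω => ∑ j, r j ω • x j) 2 μ := by
  obtain ⟨T, hT, hi, hj⟩ := h.flip i
  rw [← eLpNorm_comp_measurePreserving (h.stronglyMeasurable_sum x).aestronglyMeasurable hT]
  congr 1; ext ω
  refine Finset.sum_congr rfl fun j _ => ?_
  by_cases hji : j = i
  · subst hji; simp [hi]
  · simp [hji, hj j hji]

theorem isUncond (h : SymmSystem μ r) : IsUncond (h.seminorm : Seminorm ℝ (Fin N → X)) where
  flip i x := congrArg ENNReal.toReal (h.eLpNorm_flip i x)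
  single i v := by
    have : (fun ω => ∑ j, r j ω • (Pi.single i v : Fin N → X) j) = fun ω => r i ω • v := by
      ext ω
      rw [Finset.sum_eq_single i (fun j _ hj => by simp [hj]) (by simp), Pi.single_eq_same]
    change (eLpNorm (fun ω => ∑ j, r j ω • (Pi.single i v : Fin N → X) j) 2 μ).toReal = ‖v‖
    rw [this, h.eLpNorm_smul_const, toReal_enorm]

theorem pi {E : Type*} [MeasurableSpace E] {ν : Measure E} [IsProbabilityMeasure ν] {φ : E → ℝ}
    (hφ : Measurable φ) (hφ1 : eLpNorm φ 2 ν = 1) {σ : E → E} (hσ : MeasurePreserving σ ν ν)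
    (hφσ : ∀ e, φ (σ e) = -φ e) (N : ℕ) :
    SymmSystem (Measure.pi fun _ : Fin N => ν) fun i g => φ (g i) where
  measurable i := hφ.comp (measurable_pi_apply i)
  eLpNorm_eq i := by
    rw [← hφ1, ← eLpNorm_comp_measurePreserving hφ.aestronglyMeasurable
      (measurePreserving_eval (fun _ : Fin N => ν) i)]
    rfl
  flip i := by
    refine ⟨fun g j => (if j = i then σ else id) (g j), measurePreserving_pi _ _ fun j => ?_,
      fun g => by simp [hφσ], fun j hj g => by simp [hj]⟩
    split_ifs
    · exact hσ
    · exact MeasurePreserving.id _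

end SymmSystem

/-- The law of a fair coin. -/
def coin : Measure Bool := (2⁻¹ : ℝ≥0∞) • Measure.count

theorem coin_singleton (b : Bool) : coin {b} = 2⁻¹ := by simp [coin]

instance : IsProbabilityMeasure coin :=
  ⟨by
    rw [coin, Measure.smul_apply, Measure.count_apply MeasurableSet.univ, Set.encard_univ,
      ENat.card_eq_coe_fintype_card, Fintype.card_bool, smul_eq_mul]
    exact ENNReal.inv_mul_cancel two_ne_zero ENNReal.ofNat_ne_top⟩

/-- The law of `N` independent fair coins. -/
def coinPi (N : ℕ) : Measure (Fin N → Bool) := Measure.pi fun _ => coin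

instance (N : ℕ) : IsProbabilityMeasure (coinPi N) := by unfold coinPi; infer_instance

instance (N : ℕ) : IsProbabilityMeasure (gaussianPi N) := by unfold gaussianPi; infer_instance

theorem lintegral_coinPi {N : ℕ} (f : (Fin N → Bool) → ℝ≥0∞) :
    ∫⁻ e, f e ∂coinPi N = (∑ e, f e) / 2 ^ N := by
  rw [lintegral_fintype, div_eq_mul_inv, Finset.sum_mul]
  refine Finset.sum_congr rfl fun e _ => ?_
  rw [coinPi, Measure.pi_singleton]
  simp [coin_singleton, ENNReal.inv_pow]

/-- The sign `±1` associated with a Boolean. -/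
def sgn (b : Bool) : ℝ := if b then 1 else -1

theorem sgn_not (b : Bool) : sgn (!b) = -sgn b := by cases b <;> simp [sgn]

theorem abs_sgn (b : Bool) : |sgn b| = 1 := by cases b <;> simp [sgn]

theorem sgn_mul_self (b : Bool) : sgn b * sgn b = 1 := by cases b <;> simp [sgn]

theorem measurePreserving_not_coin : MeasurePreserving not coin coin := by
  refine ⟨measurable_of_finite _, ?_⟩
  refine Measure.ext_of_singleton fun b => ?_
  rw [Measure.map_apply (measurable_of_finite _) (measurableSet_singleton b), coin_singleton]
  rw [show not ⁻¹' {b} = {!b} by ext c; cases b <;> cases c <;> simp, coin_singleton]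

theorem symmSystem_coinPi (N : ℕ) : SymmSystem (coinPi N) fun i e => sgn (e i) := by
  refine SymmSystem.pi (measurable_of_finite _) ?_ measurePreserving_not_coin sgn_not N
  have h : eLpNorm sgn 2 coin = eLpNorm (fun _ : Bool => (1 : ℝ)) 2 coin :=
    eLpNorm_congr_norm_ae (Eventually.of_forall fun b => by
      rw [Real.norm_eq_abs, abs_sgn, norm_one])
  rw [h, eLpNorm_const _ (by norm_num) (IsProbabilityMeasure.ne_zero _), measure_univ]
  simp

theorem symmSystem_gaussianPi (N : ℕ) : SymmSystem (gaussianPi N) fun i g => g i := by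
  refine SymmSystem.pi (φ := fun t => t) measurable_id ?_ (σ := fun t => -t)
    ⟨measurable_neg, by rw [gaussianReal_map_neg, neg_zero]⟩ (fun _ => rfl) N
  have h : eLpNorm (fun t : ℝ => t) 2 (gaussianReal 0 1) ^ 2 = 1 := by
    rw [SymmSystem.eLpNorm_two_sq]
    have hv := variance_id_gaussianReal (μ := 0) (v := 1)
    rw [variance_eq_integral measurable_id.aemeasurable] at hv
    simp only [id, integral_id_gaussianReal, sub_zero, NNReal.coe_one] at hv
    rw [← ENNReal.ofReal_one, ← hv, ofReal_integral_eq_lintegral_ofReal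
      (by simpa using (memLp_id_gaussianReal (μ := 0) (v := 1) 2).integrable_sq)
      (Eventually.of_forall fun t => sq_nonneg t)]
    refine lintegral_congr fun t => ?_
    rw [← ofReal_norm, ← ENNReal.ofReal_pow (norm_nonneg _), Real.norm_eq_abs, sq_abs]
  have h2 : (1 : ℝ≥0∞) ^ 2 = 1 := one_pow 2
  exact (ENNReal.pow_right_strictMono two_ne_zero).injective (h.trans h2.symm)

variable (X) in
/-- The seminorm `x ↦ (E‖∑ rᵢ xᵢ‖²)^{1/2}` for independent Rademacher variables `rᵢ`. -/
def radNorm (N : ℕ) : Seminorm ℝ (Fin N → X) := (symmSystem_coinPi N).seminorm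

variable (X) in
/-- The seminorm `x ↦ (E‖∑ γᵢ xᵢ‖²)^{1/2}` for independent standard Gaussian variables `γᵢ`. -/
def gaussNorm (N : ℕ) : Seminorm ℝ (Fin N → X) := (symmSystem_gaussianPi N).seminorm

theorem isUncond_radNorm (N : ℕ) : IsUncond (radNorm X N) := (symmSystem_coinPi N).isUncond

theorem isUncond_gaussNorm (N : ℕ) : IsUncond (gaussNorm X N) := (symmSystem_gaussianPi N).isUncond

theorem ofReal_radNorm_sq {N : ℕ} (x : Fin N → X) :
    ENNReal.ofReal (radNorm X N x) ^ 2 = ∫⁻ e, ‖∑ i, sgn (e i) • x i‖ₑ ^ 2 ∂coinPi N :=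
  (symmSystem_coinPi N).ofReal_seminorm_sq x

theorem ofReal_gaussNorm_sq {N : ℕ} (x : Fin N → X) :
    ENNReal.ofReal (gaussNorm X N x) ^ 2 = ∫⁻ g, ‖∑ i, g i • x i‖ₑ ^ 2 ∂gaussianPi N :=
  (symmSystem_gaussianPi N).ofReal_seminorm_sq x

/-- Any signs can be introduced in an unconditional seminorm. -/
theorem IsUncond.sgn_smul {N : ℕ} {S : Seminorm ℝ (Fin N → X)} (hS : IsUncond S) (e : Fin N → Bool)
    (x : Fin N → X) : S (fun i => sgn (e i) • x i) = S x := by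
  refine le_antisymm (hS.smul_le x fun i => (abs_sgn _).le) ?_
  refine le_trans (le_of_eq ?_) (hS.smul_le (fun i => sgn (e i) • x i) (c := fun i => sgn (e i))
    fun i => (abs_sgn _).le)
  congr 1; ext i
  rw [smul_smul, sgn_mul_self, one_smul]

theorem IsUncond.smul_le_mul {N : ℕ} {S : Seminorm ℝ (Fin N → X)} (hS : IsUncond S)
    {c : Fin N → ℝ} {M : ℝ} (hc : ∀ i, |c i| ≤ M) (hM : 0 ≤ M) (x : Fin N → X) :
    S (fun i => c i • x i) ≤ M * S x := by
  rcases hM.eq_or_lt with rfl | hM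
  · have : (fun i => c i • x i) = 0 := by
      ext i; simp [abs_nonpos_iff.1 (hc i)]
    simp [this]
  · have h : (fun i => c i • x i) = M • fun i => (c i / M) • x i := by
      ext i; simp only [Pi.smul_apply, smul_smul]; congr 1; field_simp
    rw [h, map_smul_eq_mul, Real.norm_of_nonneg hM.le]
    gcongr
    exact hS.smul_le x fun i => by rw [abs_div, abs_of_pos hM]; exact div_le_one_of_le₀ (hc i) hM.le

theorem IsUncond.abs_smul {N : ℕ} {S : Seminorm ℝ (Fin N → X)} (hS : IsUncond S) (c : Fin N → ℝ)
    (x : Fin N → X) : S (fun i => |c i| • x i) = S (fun i => c i • x i) := by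
  rw [← hS.sgn_smul (fun i => decide (0 ≤ c i)) fun i => |c i| • x i]
  congr 1; ext i
  rw [smul_smul]
  congr 1
  by_cases h : 0 ≤ c i
  · simp [sgn, h, abs_of_nonneg h]
  · simp [sgn, h, abs_of_neg (not_le.1 h)]

end RandomSeminorm

section Kahane

variable {X : Type*} [NormedAddCommGroup X] [NormedSpace ℝ X]

theorem sum_fin_succ_bool {M : Type*} [AddCommMonoid M] {n : ℕ} (F : (Fin (n + 1) → Bool) → M) :
    ∑ e, F e = ∑ e : Fin n → Bool, (F (Fin.cons true e) + F (Fin.cons false e)) := by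
  rw [← (Fin.consEquiv fun _ => Bool).sum_comp, Fintype.sum_prod_type, Fintype.sum_bool,
    ← Finset.sum_add_distrib]
  rfl

theorem sq_sum_add_sq_sum_le {ι : Type*} (s : Finset ι) {a b c : ι → ℝ} (hc : ∀ i, 0 ≤ c i)
    (h : ∀ i, a i ^ 2 + b i ^ 2 ≤ 2 * c i ^ 2) :
    (∑ i ∈ s, a i) ^ 2 + (∑ i ∈ s, b i) ^ 2 ≤ 2 * (∑ i ∈ s, c i) ^ 2 := by
  induction s using Finset.induction_on with
  | empty => simp
  | insert i s hi ih =>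
    simp only [Finset.sum_insert hi]
    set A := ∑ i ∈ s, a i
    set B := ∑ i ∈ s, b i
    have hC : 0 ≤ ∑ i ∈ s, c i := Finset.sum_nonneg fun i _ => hc i
    set C := ∑ i ∈ s, c i
    have h2 : a i * A + b i * B ≤ 2 * (c i * C) := by
      refine abs_le_of_sq_le_sq' ?_ (by have := hc i; positivity) |>.2
      calc (a i * A + b i * B) ^ 2 ≤ (a i ^ 2 + b i ^ 2) * (A ^ 2 + B ^ 2) := by
            nlinarith [sq_nonneg (a i * B - b i * A)]
        _ ≤ (2 * c i ^ 2) * (2 * C ^ 2) := by gcongr; exact h i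
        _ = _ := by ring
    nlinarith [h i]

theorem two_point_hypercontractivity {ρ : ℝ} (hρ0 : 0 ≤ ρ) (hρ : ρ ^ 2 = 1 / 3) (u v : X) :
    ‖u + ρ • v‖ ^ 4 + ‖u - ρ • v‖ ^ 4 ≤ 2 * ((‖u + v‖ ^ 2 + ‖u - v‖ ^ 2) / 2) ^ 2 := by
  have hρ1 : ρ ≤ 1 := by nlinarith
  have key : ∀ w : X, ‖u + ρ • w‖ ≤ (1 + ρ) / 2 * ‖u + w‖ + (1 - ρ) / 2 * ‖u - w‖ := fun w => by
    have h : u + ρ • w = ((1 + ρ) / 2) • (u + w) + ((1 - ρ) / 2) • (u - w) := by module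
    rw [h]
    refine (norm_add_le _ _).trans ?_
    rw [norm_smul, norm_smul, Real.norm_of_nonneg (by linarith), Real.norm_of_nonneg (by linarith)]
  have h1 := key v
  have h2 := key (-v)
  rw [smul_neg, ← sub_eq_add_neg, ← sub_eq_add_neg, sub_neg_eq_add] at h2
  set a := ‖u + v‖
  set b := ‖u - v‖
  calc _ ≤ ((1 + ρ) / 2 * a + (1 - ρ) / 2 * b) ^ 4 + ((1 + ρ) / 2 * b + (1 - ρ) / 2 * a) ^ 4 := by
        gcongr
    _ = 2 * (((a + b) / 2) ^ 4 + 6 * ρ ^ 2 * ((a + b) / 2) ^ 2 * ((a - b) / 2) ^ 2 +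
          (ρ ^ 2) ^ 2 * ((a - b) / 2) ^ 4) := by ring
    _ ≤ _ := by
        rw [hρ]
        nlinarith [sq_nonneg (((a - b) / 2) ^ 2)]

/-- Hypercontractivity of Rademacher sums with values in a normed space. -/
theorem hypercontractivity {ρ : ℝ} (hρ0 : 0 ≤ ρ) (hρ : ρ ^ 2 = 1 / 3) {n : ℕ} (x₀ : X)
    (x : Fin n → X) :
    (∑ e : Fin n → Bool, ‖x₀ + ρ • ∑ i, sgn (e i) • x i‖ ^ 4) / 2 ^ n ≤
      ((∑ e : Fin n → Bool, ‖x₀ + ∑ i, sgn (e i) • x i‖ ^ 2) / 2 ^ n) ^ 2 := by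
  induction n generalizing x₀ with
  | zero => simp [← pow_mul]
  | succ n ih =>
    set R : (Fin n → Bool) → X := fun e => ∑ i, sgn (e i) • x i.succ with hR
    have hT : sgn true = 1 := rfl
    have hF : sgn false = -1 := rfl
    have ih1 := ih (x₀ + ρ • x 0) (fun i => x i.succ)
    have ih2 := ih (x₀ - ρ • x 0) (fun i => x i.succ)
    have e1 : ∑ e : Fin (n + 1) → Bool, ‖x₀ + ρ • ∑ i, sgn (e i) • x i‖ ^ 4 =
        ∑ e, ‖x₀ + ρ • x 0 + ρ • R e‖ ^ 4 + ∑ e, ‖x₀ - ρ • x 0 + ρ • R e‖ ^ 4 := by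
      rw [sum_fin_succ_bool, ← Finset.sum_add_distrib]
      refine Finset.sum_congr rfl fun e _ => ?_
      simp only [Fin.sum_univ_succ, Fin.cons_zero, Fin.cons_succ, hT, hF, one_smul, neg_smul]
      congr 3 <;> simp only [hR] <;> module
    have e2 : ∑ e : Fin (n + 1) → Bool, ‖x₀ + ∑ i, sgn (e i) • x i‖ ^ 2 =
        2 * ∑ e, (‖(x₀ + R e) + x 0‖ ^ 2 + ‖(x₀ + R e) - x 0‖ ^ 2) / 2 := by
      rw [sum_fin_succ_bool, Finset.mul_sum]
      refine Finset.sum_congr rfl fun e _ => ?_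
      simp only [Fin.sum_univ_succ, Fin.cons_zero, Fin.cons_succ, hT, hF, one_smul, neg_smul]
      rw [mul_div_cancel₀ _ two_ne_zero]
      congr 3 <;> simp only [hR] <;> module
    have e3 := sq_sum_add_sq_sum_le (Finset.univ : Finset (Fin n → Bool))
      (a := fun e => ‖(x₀ + R e) + ρ • x 0‖ ^ 2) (b := fun e => ‖(x₀ + R e) - ρ • x 0‖ ^ 2)
      (c := fun e => (‖(x₀ + R e) + x 0‖ ^ 2 + ‖(x₀ + R e) - x 0‖ ^ 2) / 2)
      (fun e => by positivity) fun e => by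
        simp only [← pow_mul]
        exact two_point_hypercontractivity hρ0 hρ _ _
    have e4 : ∀ e, x₀ + R e + ρ • x 0 = x₀ + ρ • x 0 + R e := fun e => by abel
    have e5 : ∀ e, x₀ + R e - ρ • x 0 = x₀ - ρ • x 0 + R e := fun e => by abel
    simp only [e4, e5] at e3
    rw [e1, e2]
    rw [div_le_iff₀ (by positivity)] at ih1 ih2 ⊢
    refine (add_le_add ih1 ih2).trans ?_
    rw [← add_mul, div_pow, div_pow, div_pow, ← add_div, pow_succ 2 n]
    calc _ ≤ 2 * (∑ e, (‖(x₀ + R e) + x 0‖ ^ 2 + ‖(x₀ + R e) - x 0‖ ^ 2) / 2) ^ 2 /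
          (2 ^ n) ^ 2 * 2 ^ n := by gcongr
      _ = _ := by field_simp

theorem radNorm_sq {N : ℕ} (x : Fin N → X) :
    radNorm X N x ^ 2 = (∑ e : Fin N → Bool, ‖∑ i, sgn (e i) • x i‖ ^ 2) / 2 ^ N := by
  have h := ofReal_radNorm_sq x
  rw [lintegral_coinPi] at h
  have h2 := congrArg ENNReal.toReal h
  rw [ENNReal.toReal_pow, ENNReal.toReal_ofReal (apply_nonneg _ _), ENNReal.toReal_div,
    ENNReal.toReal_sum (fun e _ => by finiteness)] at h2
  simpa using h2

theorem kahane_four {N : ℕ} (x : Fin N → X) :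
    (∑ e : Fin N → Bool, ‖∑ i, sgn (e i) • x i‖ ^ 4) / 2 ^ N ≤ 9 * (radNorm X N x ^ 2) ^ 2 := by
  have hρ : (√(1 / 3) : ℝ) ^ 2 = 1 / 3 := Real.sq_sqrt (by norm_num)
  have h := hypercontractivity (Real.sqrt_nonneg (1 / 3)) hρ (0 : X) x
  have h4 : (√(1 / 3) : ℝ) ^ 4 = 1 / 9 := by
    rw [show 4 = 2 * 2 by rfl, pow_mul, hρ]; norm_num
  simp only [zero_add, norm_smul, mul_pow, Real.norm_of_nonneg (Real.sqrt_nonneg _), h4,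
    ← Finset.mul_sum, ← radNorm_sq] at h
  rw [mul_div_assoc] at h
  linarith

theorem radNorm_le_avg_norm {N : ℕ} (x : Fin N → X) :
    radNorm X N x ≤ 9 * ((∑ e : Fin N → Bool, ‖∑ i, sgn (e i) • x i‖) / 2 ^ N) := by
  set s := radNorm X N x with hs
  have hs0 : 0 ≤ s := apply_nonneg _ _
  rcases hs0.eq_or_lt with h0 | h0
  · rw [← h0]; positivity
  have h4 := kahane_four x
  rw [← hs] at h4
  have hpt : ∀ f : ℝ, 0 ≤ f → f ^ 2 ≤ (9 / 2) * s * f + f ^ 4 / ((9 / 2) * s) ^ 2 := fun f hf => by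
    rcases le_total f ((9 / 2) * s) with h | h
    · have : 0 ≤ f ^ 4 / ((9 / 2) * s) ^ 2 := by positivity
      nlinarith
    · have : f ^ 2 ≤ f ^ 4 / ((9 / 2) * s) ^ 2 := by
        rw [le_div_iff₀ (by positivity), show f ^ 4 = f ^ 2 * f ^ 2 by ring]
        gcongr
      have : 0 ≤ (9 / 2) * s * f := by positivity
      linarith
  have h2 : s ^ 2 ≤ (9 / 2) * s * ((∑ e : Fin N → Bool, ‖∑ i, sgn (e i) • x i‖) / 2 ^ N) +
      (9 * (s ^ 2) ^ 2) / ((9 / 2) * s) ^ 2 := by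
    calc s ^ 2 = (∑ e : Fin N → Bool, ‖∑ i, sgn (e i) • x i‖ ^ 2) / 2 ^ N := radNorm_sq x
      _ ≤ (∑ e : Fin N → Bool, ((9 / 2) * s * ‖∑ i, sgn (e i) • x i‖ +
            ‖∑ i, sgn (e i) • x i‖ ^ 4 / ((9 / 2) * s) ^ 2)) / 2 ^ N := by
          gcongr with e _
          exact hpt _ (norm_nonneg _)
      _ = (9 / 2) * s * ((∑ e : Fin N → Bool, ‖∑ i, sgn (e i) • x i‖) / 2 ^ N) +
          ((∑ e : Fin N → Bool, ‖∑ i, sgn (e i) • x i‖ ^ 4) / 2 ^ N) / ((9 / 2) * s) ^ 2 := by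
          rw [Finset.sum_add_distrib, ← Finset.mul_sum, ← Finset.sum_div]; ring
      _ ≤ _ := by gcongr
  have h3 : (9 * (s ^ 2) ^ 2) / ((9 / 2) * s) ^ 2 = 4 / 9 * s ^ 2 := by field_simp; norm_num
  rw [h3] at h2
  have h5 : s * (5 / 9 * s) ≤
      s * ((9 / 2) * ((∑ e : Fin N → Bool, ‖∑ i, sgn (e i) • x i‖) / 2 ^ N)) := by linarith
  have h6 := le_of_mul_le_mul_left h5 h0
  linarith

end Kahane

section Compare

variable {X : Type*} [NormedAddCommGroup X] [NormedSpace ℝ X]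

theorem gammaSeqNorm_eq_iSup (d : ℕ → X) :
    gammaSeqNorm d = ⨆ N, ENNReal.ofReal (gaussNorm X N fun i => d i) := by
  refine iSup_congr fun N => ?_
  have h := ofReal_gaussNorm_sq fun i : Fin N => d i
  simp only [enorm_eq_nnnorm] at h
  rw [← h, ← ENNReal.rpow_two, ← ENNReal.rpow_mul]
  norm_num

theorem sum_lintegral_div_two_pow {Ω : Type*} [MeasurableSpace Ω] {μ : Measure Ω} {N : ℕ}
    {f : (Fin N → Bool) → Ω → ℝ≥0∞} (hf : ∀ e, Measurable (f e)) :
    (∑ e, ∫⁻ ω, f e ω ∂μ) / 2 ^ N = ∫⁻ ω, (∑ e, f e ω) / 2 ^ N ∂μ := by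
  simp_rw [div_eq_mul_inv]
  rw [lintegral_mul_const _ (Finset.measurable_fun_sum _ fun e _ => hf e),
    lintegral_finsetSum _ fun e _ => hf e]

theorem lintegral_radNorm_smul_sq {N : ℕ} (x : Fin N → X) :
    ∫⁻ g, ENNReal.ofReal (radNorm X N fun i => g i • x i) ^ 2 ∂gaussianPi N =
      ENNReal.ofReal (gaussNorm X N x) ^ 2 := by
  have h : ∀ e : Fin N → Bool, ∫⁻ g, ‖∑ i, sgn (e i) • g i • x i‖ₑ ^ 2 ∂gaussianPi N =
      ENNReal.ofReal (gaussNorm X N x) ^ 2 := fun e => by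
    rw [← (isUncond_gaussNorm N).sgn_smul e x, ofReal_gaussNorm_sq]
    simp only [smul_comm (sgn _)]
  have hm : ∀ e : Fin N → Bool, Measurable fun g : Fin N → ℝ =>
      ‖∑ i, sgn (e i) • g i • x i‖ₑ ^ 2 := fun e =>
    (Finset.stronglyMeasurable_fun_sum _ fun i _ => ((measurable_pi_apply
      i).stronglyMeasurable.smul_const (x i)).const_smul (sgn (e i))).enorm.pow_const 2
  simp_rw [ofReal_radNorm_sq, lintegral_coinPi]
  rw [← sum_lintegral_div_two_pow hm]
  simp_rw [h]
  rw [Finset.sum_const, Finset.card_univ, Fintype.card_fun, Fintype.card_bool, Fintype.card_fin,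
    nsmul_eq_mul, Nat.cast_pow, Nat.cast_ofNat]
  rw [ENNReal.mul_div_right_comm, ENNReal.div_self (by simp) (by finiteness), one_mul]

theorem lintegral_sq_le {Ω : Type*} [MeasurableSpace Ω] {μ : Measure Ω} [IsProbabilityMeasure μ]
    {F : Type*} [NormedAddCommGroup F] {f : Ω → F} (hf : AEStronglyMeasurable f μ) :
    (∫⁻ ω, ‖f ω‖ₑ ∂μ) ^ 2 ≤ ∫⁻ ω, ‖f ω‖ₑ ^ 2 ∂μ := by
  rw [← SymmSystem.eLpNorm_two_sq, ← eLpNorm_one_eq_lintegral_enorm]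
  gcongr
  exact eLpNorm_le_eLpNorm_of_exponent_le one_le_two hf

theorem integrable_abs_gaussianReal : Integrable (fun t : ℝ => |t|) (gaussianReal 0 1) := by
  have h : Integrable id (gaussianReal 0 1) :=
    (memLp_id_gaussianReal (μ := 0) (v := 1) 1).integrable le_rfl
  exact h.abs

theorem integral_abs_gaussianReal_pos : 0 < ∫ t, |t| ∂gaussianReal 0 1 := by
  refine (integral_nonneg fun t => abs_nonneg t).lt_of_ne' fun h => ?_
  rw [integral_eq_zero_iff_of_nonneg (fun t => abs_nonneg t) integrable_abs_gaussianReal] at h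
  have hv := variance_id_gaussianReal (μ := 0) (v := 1)
  rw [variance_eq_integral measurable_id.aemeasurable] at hv
  simp only [id, integral_id_gaussianReal, sub_zero, NNReal.coe_one] at hv
  have h0 : ∫ t : ℝ, t ^ 2 ∂gaussianReal 0 1 = 0 :=
    integral_eq_zero_of_ae (h.mono fun t ht => by simpa using ht)
  rw [h0] at hv
  exact zero_ne_one hv

theorem radNorm_sq_le_gaussNorm_sq [CompleteSpace X] {N : ℕ} (x : Fin N → X) :
    ENNReal.ofReal (∫ t, |t| ∂gaussianReal 0 1) ^ 2 * ENNReal.ofReal (radNorm X N x) ^ 2 ≤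
      ENNReal.ofReal (gaussNorm X N x) ^ 2 := by
  set a := ∫ t, |t| ∂gaussianReal 0 1 with ha
  have hi : ∀ i : Fin N, Integrable (fun g : Fin N → ℝ => |g i|) (gaussianPi N) := fun i =>
    (measurePreserving_eval (fun _ : Fin N => gaussianReal 0 1) i).integrable_comp_of_integrable
      integrable_abs_gaussianReal
  have hint : ∀ i : Fin N, ∫ g, |g i| ∂gaussianPi N = a := fun i =>
by
    have h := integral_map (μ := gaussianPi N) (measurable_pi_apply i).aemeasurable
      (f := fun t : ℝ => |t|) (by fun_prop)
    rw [← h, gaussianPi, (measurePreserving_eval (fun _ : Fin N => gaussianReal 0 1) i).map_eq]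
  have hm : ∀ e : Fin N → Bool, StronglyMeasurable fun g : Fin N → ℝ =>
      ∑ i, sgn (e i) • |g i| • x i := fun e =>
    Finset.stronglyMeasurable_fun_sum _ fun i _ => ((by fun_prop :
      Measurable fun g : Fin N → ℝ => |g i|).stronglyMeasurable.smul_const (x i)).const_smul _
  have hpt : ∀ e : Fin N → Bool, ENNReal.ofReal a ^ 2 * ‖∑ i, sgn (e i) • x i‖ₑ ^ 2 ≤
      ∫⁻ g, ‖∑ i, sgn (e i) • |g i| • x i‖ₑ ^ 2 ∂gaussianPi N := fun e => by
    have h1 : ∫ g, ∑ i, sgn (e i) • |g i| • x i ∂gaussianPi N = a • ∑ i, sgn (e i) • x i := by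
      rw [integral_finsetSum (f := fun i (g : Fin N → ℝ) => sgn (e i) • |g i| • x i) _
        fun i _ => ((hi i).smul_const (x i)).smul (sgn (e i)), Finset.smul_sum]
      refine Finset.sum_congr rfl fun i _ => ?_
      rw [integral_smul, integral_smul_const, hint, smul_comm]
    refine le_trans (le_of_eq ?_) ((pow_le_pow_left' (enorm_integral_le_lintegral_enorm
      (μ := gaussianPi N) fun g => ∑ i, sgn (e i) • |g i| • x i) 2).trans
      (lintegral_sq_le (hm e).aestronglyMeasurable))
    rw [h1, enorm_smul, mul_pow, Real.enorm_of_nonneg integral_abs_gaussianReal_pos.le]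
  calc _ = (∑ e : Fin N → Bool, ENNReal.ofReal a ^ 2 * ‖∑ i, sgn (e i) • x i‖ₑ ^ 2) / 2 ^ N := by
        rw [ofReal_radNorm_sq, lintegral_coinPi, ← Finset.mul_sum, mul_div_assoc]
    _ ≤ (∑ e : Fin N → Bool, ∫⁻ g, ‖∑ i, sgn (e i) • |g i| • x i‖ₑ ^ 2 ∂gaussianPi N) / 2 ^ N := by
        gcongr with e _
        exact hpt e
    _ = ∫⁻ g, ENNReal.ofReal (radNorm X N fun i => |g i| • x i) ^ 2 ∂gaussianPi N := by
        rw [sum_lintegral_div_two_pow fun e => (hm e).enorm.pow_const 2]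
        simp_rw [ofReal_radNorm_sq, lintegral_coinPi]
    _ = _ := by
        simp_rw [(isUncond_radNorm N).abs_smul _ x]
        exact lintegral_radNorm_smul_sq x

theorem sum_lintegral_eq_lintegral_avg [CompleteSpace X] {Ω : Type} {m : MeasurableSpace Ω}
    {P : Measure Ω} {d : ℕ → Ω → X} (hd : ∀ j, StronglyMeasurable (d j)) (q : ℝ) (n : ℕ) :
    (∑ e : Fin n → Bool, ∫⁻ ω, (‖∑ j : Fin n, (if e j then (1 : ℝ) else -1) • d j ω‖₊ : ℝ≥0∞) ^ q
      ∂P) / 2 ^ n =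
    ∫⁻ ω, (∑ e : Fin n → Bool, ‖∑ j : Fin n, sgn (e j) • d j ω‖ₑ ^ q) / 2 ^ n ∂P := by
  rw [sum_lintegral_div_two_pow fun e => ?_]
  · rfl
  · exact (Finset.stronglyMeasurable_fun_sum _ fun (i : Fin n) _ =>
      (hd i).const_smul (if e i then (1 : ℝ) else -1)).enorm.pow_const q

theorem IsUMDminus.momentBound_radNorm [CompleteSpace X] (h : IsUMDminus X) :
    ∃ C : ℝ≥0, ∀ N, MomentBound (radNorm X N) 2 C := by
  obtain ⟨β, hβ, h⟩ := h 2 one_lt_two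
  refine ⟨(Real.toNNReal β) ^ 2, fun N Ω m P _ ℱ d hd => ?_⟩
  have h1 := h Ω m P inferInstance ℱ d hd N
  rw [sum_lintegral_eq_lintegral_avg hd.stronglyMeasurable] at h1
  have h2 := ENNReal.rpow_le_rpow h1 (zero_le_two (α := ℝ))
  rw [ENNReal.mul_rpow_of_nonneg _ _ zero_le_two, ← ENNReal.rpow_mul, ← ENNReal.rpow_mul,
    one_div_mul_cancel two_ne_zero, ENNReal.rpow_one, ENNReal.rpow_one] at h2
  refine h2.trans (le_of_eq ?_)
  congr 1
  · rw [ENNReal.rpow_two]; rfl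
  · refine lintegral_congr fun ω => ?_
    simp_rw [ENNReal.rpow_two]
    rw [ofReal_radNorm_sq, lintegral_coinPi]

theorem IsUMDminus.momentBound_gaussNorm [CompleteSpace X] (h : IsUMDminus X) :
    ∃ C : ℝ≥0, ∀ N, MomentBound (gaussNorm X N) 2 C := by
  obtain ⟨C, hC⟩ := h.momentBound_radNorm
  set a := Real.toNNReal (∫ t, |t| ∂gaussianReal 0 1) with ha
  have ha0 : a ^ 2 ≠ 0 := pow_ne_zero _ (Real.toNNReal_pos.2 integral_abs_gaussianReal_pos).ne'
  refine ⟨C * (a ^ 2)⁻¹, fun N Ω m P _ ℱ d hd => (hC N Ω m P inferInstance ℱ d hd).trans ?_⟩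
  rw [ENNReal.coe_mul, mul_assoc, ENNReal.coe_inv ha0]
  gcongr
  rw [← lintegral_const_mul' _ _ (by simpa using ha0)]
  refine lintegral_mono fun ω => ?_
  rw [ENNReal.rpow_two, ENNReal.rpow_two, mul_comm, ← div_eq_mul_inv,
    ENNReal.le_div_iff_mul_le (Or.inl (by simpa using ha0)) (Or.inl ENNReal.coe_ne_top), mul_comm,
    ENNReal.coe_pow]
  exact radNorm_sq_le_gaussNorm_sq _

theorem IsUMDminus.one_sided_bdg [CompleteSpace X] (h : IsUMDminus X) {p : ℝ} (hp : 1 ≤ p) :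
    ∃ C : ℝ, 0 < C ∧
        ∀ (Ω : Type) (m : MeasurableSpace Ω) (P : Measure Ω), IsProbabilityMeasure P →
          ∀ (ℱ : Filtration ℕ m) (d : ℕ → Ω → X), IsMartDiffSeq ℱ P d →
            (∫⁻ ω, (⨆ M : ℕ, (‖∑ n ∈ Finset.range M, d n ω‖₊ : ℝ≥0∞)) ^ p ∂P) ≤
              ENNReal.ofReal C * ∫⁻ ω, gammaSeqNorm (fun n => d n ω) ^ p ∂P := by
  obtain ⟨C, hC⟩ := h.momentBound_gaussNorm
  obtain ⟨K, hK⟩ := exists_maximal_moment_bound (X := X) two_pos hp C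
  have hp0 : 0 < p := by linarith
  refine ⟨K + 1, by positivity, fun Ω m P _ ℱ d hd => ?_⟩
  calc _ ≤ ∫⁻ ω, ⨆ N, ENNReal.ofReal (maxPartialSum (fun i => d i ω) N) ^ p ∂P := by
        refine lintegral_mono fun ω => ?_
        have hsup := (ENNReal.orderIsoRpow p hp0).map_iSup
          fun M : ℕ => (‖∑ n ∈ Finset.range M, d n ω‖₊ : ℝ≥0∞)
        simp only [ENNReal.orderIsoRpow_apply] at hsup
        rw [hsup]
        refine iSup_mono fun M => ?_
        gcongr
        rw [ENNReal.ofReal_coe_nnreal, ENNReal.coe_le_coe, ← NNReal.coe_le_coe]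
        exact norm_le_maxPartialSum _ le_rfl
    _ = ⨆ N, ∫⁻ ω, ENNReal.ofReal (maxPartialSum (fun i => d i ω) N) ^ p ∂P := by
        refine lintegral_iSup (fun N => ?_) fun N N' hN ω => ?_
        · exact (measurable_maxPartialSum fun i _ =>
            hd.stronglyMeasurable i).coe_nnreal_real.ennreal_ofReal.pow_const p
        · have := maxPartialSum_mono (fun i => d i ω) hN
          dsimp only
          gcongr
    _ ≤ _ := iSup_le fun N => by
        refine (hK N _ (hC N) (isUncond_gaussNorm N) Ω m P inferInstance ℱ d hd).trans ?_
        have hKK : (K : ℝ≥0∞) ≤ ENNReal.ofReal ((K : ℝ) + 1) := by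
          rw [← ENNReal.ofReal_coe_nnreal]
          exact ENNReal.ofReal_le_ofReal (by linarith)
        gcongr with ω
        rw [gammaSeqNorm_eq_iSup]
        exact le_iSup (fun N => ENNReal.ofReal (gaussNorm X N fun i => d i ω)) N

end Compare

section Converse

variable {X : Type*} [NormedAddCommGroup X] [NormedSpace ℝ X]

theorem measurePreserving_gaussianPi_castLE {N M : ℕ} (h : N ≤ M) :
    MeasurePreserving (fun (g : Fin M → ℝ) (i : Fin N) => g (Fin.castLE h i)) (gaussianPi M)
      (gaussianPi N) := by
  refine ⟨by fun_prop, ?_⟩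
  have hi : iIndepFun (fun (i : Fin M) (g : Fin M → ℝ) => g i) (gaussianPi M) :=
    iIndepFun_pi (μ := fun _ : Fin M => gaussianReal 0 1) (X := fun _ t => t)
      fun _ => measurable_id.aemeasurable
  have h2 := hi.precomp (Fin.castLE_injective h)
  rw [iIndepFun_iff_map_fun_eq_pi_map fun i => (measurable_pi_apply _).aemeasurable] at h2
  rw [h2]
  unfold gaussianPi
  congr 1
  ext1 i
  rw [(measurePreserving_eval (fun _ : Fin M => gaussianReal 0 1) (Fin.castLE h i)).map_eq]

theorem gaussNorm_ite_lt {N M : ℕ} (h : N ≤ M) (x : ℕ → X) :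
    gaussNorm X M (fun i => if (i : ℕ) < N then x i else 0) = gaussNorm X N fun i => x i := by
  have key : ENNReal.ofReal (gaussNorm X M fun i => if (i : ℕ) < N then x i else 0) ^ 2 =
      ENNReal.ofReal (gaussNorm X N fun i => x i) ^ 2 := by
    rw [ofReal_gaussNorm_sq, ofReal_gaussNorm_sq,
      ← (measurePreserving_gaussianPi_castLE h).lintegral_comp]
    · refine lintegral_congr fun g => ?_
      congr 2
      obtain ⟨k, rfl⟩ := Nat.exists_eq_add_of_le h
      rw [Fin.sum_univ_add]
      simp
      rfl
    · exact ((symmSystem_gaussianPi N).stronglyMeasurable_sum _).enorm.pow_const 2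
  have h2 := (ENNReal.pow_right_strictMono two_ne_zero).injective key
  exact (ENNReal.ofReal_eq_ofReal_iff (apply_nonneg _ _) (apply_nonneg _ _)).1 h2

theorem gammaSeqNorm_ite_lt_le (x : ℕ → X) (N : ℕ) :
    gammaSeqNorm (fun i => if i < N then x i else 0) ≤
      ENNReal.ofReal (gaussNorm X N fun i => x i) := by
  rw [gammaSeqNorm_eq_iSup]
  refine iSup_le fun M => ENNReal.ofReal_le_ofReal ?_
  rcases le_total N M with h | h
  · exact (gaussNorm_ite_lt h x).le
  · rw [← gaussNorm_ite_lt h fun i => if i < N then x i else 0]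
    refine le_trans (le_of_eq ?_) ((isUncond_gaussNorm N).ite_le (fun i => x i)
      fun i => (i : ℕ) < M)
    congr 1; ext i; simp

theorem momentBound_gaussNorm_of_one_sided_bdg [CompleteSpace X] {p C : ℝ} (hp : 1 ≤ p)
    (h : ∀ (Ω : Type) (m : MeasurableSpace Ω) (P : Measure Ω), IsProbabilityMeasure P →
      ∀ (ℱ : Filtration ℕ m) (d : ℕ → Ω → X), IsMartDiffSeq ℱ P d →
        (∫⁻ ω, (⨆ M : ℕ, (‖∑ n ∈ Finset.range M, d n ω‖₊ : ℝ≥0∞)) ^ p ∂P) ≤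
          ENNReal.ofReal C * ∫⁻ ω, gammaSeqNorm (fun n => d n ω) ^ p ∂P) (N : ℕ) :
    MomentBound (gaussNorm X N) p C.toNNReal := by
  intro Ω m P _ ℱ d hd
  have hd' := hd.indicator (A := fun j => if j < N then Set.univ else ∅) fun j => by
    split_ifs
    · exact @MeasurableSet.univ _ (ℱ j)
    · exact @MeasurableSet.empty _ (ℱ j)
  have hd'' : (fun j => (if j < N then Set.univ else ∅ : Set Ω).indicator (d j)) =
      fun j ω => if j < N then d j ω else 0 := by
    ext j ω; split_ifs <;> simp
  rw [hd''] at hd'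
  refine le_trans (lintegral_mono fun ω => ?_) ((h Ω m P inferInstance ℱ _ hd').trans ?_)
  · dsimp only
    gcongr
    refine le_trans (le_of_eq ?_) (le_iSup _ N)
    rw [enorm_eq_nnnorm]
    congr 2
    exact Finset.sum_congr rfl fun j hj => by simp [Finset.mem_range.1 hj]
  · gcongr with ω
    · exact le_rfl
    · exact gammaSeqNorm_ite_lt_le (fun i => d i ω) N

theorem exists_momentBound_of_momentBound [CompleteSpace X] {p q : ℝ} (hp : 0 < p) (hq : 1 ≤ q)
    {S : ∀ N, Seminorm ℝ (Fin N → X)} (hS : ∀ N, IsUncond (S N)) {C : ℝ≥0}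
    (h : ∀ N, MomentBound (S N) p C) : ∃ K : ℝ≥0, ∀ N, MomentBound (S N) q K := by
  obtain ⟨K, hK⟩ := exists_maximal_moment_bound (X := X) hp hq C
  refine ⟨K, fun N Ω m P _ ℱ d hd => le_trans (lintegral_mono fun ω => ?_)
    (hK N _ (h N) (hS N) Ω m P inferInstance ℱ d hd)⟩
  have := norm_le_maxPartialSum (fun i => d i ω) (le_refl N)
  have h2 : ‖∑ j ∈ Finset.range N, d j ω‖ₑ ≤
      ENNReal.ofReal (maxPartialSum (fun i => d i ω) N) := by
    rw [← ofReal_norm]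
    exact ENNReal.ofReal_le_ofReal this
  have hq0 : 0 ≤ q := by linarith
  dsimp only
  gcongr

theorem ofReal_radNorm_rpow_le {N : ℕ} (x : Fin N → X) {q : ℝ} (hq : 1 ≤ q) :
    ENNReal.ofReal (radNorm X N x) ^ q ≤
      9 ^ q * ((∑ e : Fin N → Bool, ‖∑ i, sgn (e i) • x i‖ₑ ^ q) / 2 ^ N) := by
  have hq0 : 0 ≤ q := by linarith
  have h1 : ENNReal.ofReal (radNorm X N x) ≤
      9 * ∑ e : Fin N → Bool, (2 ^ N)⁻¹ * ‖∑ i, sgn (e i) • x i‖ₑ := by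
    refine (ENNReal.ofReal_le_ofReal (radNorm_le_avg_norm x)).trans (le_of_eq ?_)
    rw [ENNReal.ofReal_mul (by norm_num), ENNReal.ofReal_div_of_pos (by positivity),
      ENNReal.ofReal_sum_of_nonneg fun _ _ => norm_nonneg _, ENNReal.ofReal_pow (by norm_num),
      ← Finset.mul_sum, ENNReal.div_eq_inv_mul]
    simp [ofReal_norm]
  refine (ENNReal.rpow_le_rpow h1 hq0).trans ?_
  rw [ENNReal.mul_rpow_of_nonneg _ _ hq0]
  gcongr
  refine (ENNReal.rpow_arith_mean_le_arith_mean_rpow _ _ _ ?_ hq).trans (le_of_eq ?_)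
  · rw [Finset.sum_const, Finset.card_univ, Fintype.card_fun, Fintype.card_bool, Fintype.card_fin,
      nsmul_eq_mul, Nat.cast_pow, Nat.cast_ofNat]
    exact ENNReal.mul_inv_cancel (by simp) (by finiteness)
  · rw [← Finset.mul_sum, ENNReal.div_eq_inv_mul]

theorem isUMDminus_of_momentBound_radNorm [CompleteSpace X] {C : ℝ≥0}
    (h : ∀ N, MomentBound (radNorm X N) 2 C) : IsUMDminus X := by
  intro q hq
  have hq0 : 0 < q := by linarith
  obtain ⟨K, hK⟩ := exists_momentBound_of_momentBound two_pos hq.le isUncond_radNorm h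
  refine ⟨(K : ℝ) ^ (1 / q) * 9 + 1, by positivity, fun Ω m P _ ℱ d hd n => ?_⟩
  rw [sum_lintegral_eq_lintegral_avg hd.stronglyMeasurable]
  have h1 := hK n Ω m P inferInstance ℱ d hd
  have h2 : ∫⁻ ω, ENNReal.ofReal (radNorm X n fun i => d i ω) ^ q ∂P ≤
      9 ^ q * ∫⁻ ω, (∑ e : Fin n → Bool, ‖∑ j : Fin n, sgn (e j) • d j ω‖ₑ ^ q) / 2 ^ n ∂P := by
    rw [← lintegral_const_mul' _ _ (by finiteness)]
    exact lintegral_mono fun ω => ofReal_radNorm_rpow_le _ hq.le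
  have h3 := ENNReal.rpow_le_rpow (h1.trans (mul_le_mul_right h2 _)) (one_div_nonneg.2 hq0.le)
  rw [← mul_assoc, ENNReal.mul_rpow_of_nonneg _ _ (by positivity),
    ENNReal.mul_rpow_of_nonneg _ _ (by positivity), ← ENNReal.rpow_mul, mul_one_div_cancel hq0.ne',
    ENNReal.rpow_one] at h3
  refine h3.trans ?_
  gcongr
  rw [← ENNReal.ofReal_coe_nnreal, ENNReal.ofReal_rpow_of_nonneg K.coe_nonneg (by positivity),
    show (9 : ℝ≥0∞) = ENNReal.ofReal 9 by norm_num, ← ENNReal.ofReal_mul (by positivity)]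
  exact ENNReal.ofReal_le_ofReal (by linarith)

end Converse

section Gambling

variable {X : Type*} [NormedAddCommGroup X] [NormedSpace ℝ X]

/-- The stakes `±1` of a gambler who plays a unit stake until losing for the first time:
the gain in round `i` when `w` is the sequence of outcomes. -/
def gain {n : ℕ} (w : Fin n → Bool) (i : Fin n) : ℝ := if ∀ l < i, w l then sgn (w i) else 0

theorem sum_gain_of_forall {n : ℕ} {w : Fin n → Bool} (h : ∀ i, w i) : ∑ i, gain w i = n := by
  simp [gain, h, sgn]

theorem exists_sum_ite_eq {n : ℕ} (γ : ℕ → ℝ) (a : ℕ → Prop) [DecidablePred a] (ha : Antitone a) :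
    ∃ m ≤ n, ∑ j ∈ Finset.range n, (if a j then γ j else 0) = ∑ j ∈ Finset.range m, γ j := by
  induction n with
  | zero => exact ⟨0, le_rfl, rfl⟩
  | succ n ih =>
    by_cases h : a n
    · exact ⟨n + 1, le_rfl, Finset.sum_congr rfl fun j hj =>
        if_pos (ha (Nat.lt_succ_iff.1 (Finset.mem_range.1 hj)) h)⟩
    · obtain ⟨m, hm, h2⟩ := ih
      exact ⟨m, hm.trans n.le_succ, by rw [Finset.sum_range_succ, h2, if_neg h, add_zero]⟩

theorem exists_sum_mul_gain_eq {n : ℕ} (γ : Fin n → ℝ) (w : Fin n → Bool) :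
    ∃ a ≤ n, ∃ b ≤ n, ∑ i, γ i * gain w i =
      2 * (∑ i with i.1 < a, γ i) - ∑ i with i.1 < b, γ i := by
  have key : ∀ a : ℕ → Prop, Antitone a →
      ∃ m ≤ n, ∑ i : Fin n, (if a i then γ i else 0) = ∑ i with i.1 < m, γ i := fun a ha => by
    set γ' : ℕ → ℝ := fun j => if h : j < n then γ ⟨j, h⟩ else 0 with hγ'
    have hγ : ∀ i : Fin n, γ i = γ' i := fun i => by simp [hγ']
    obtain ⟨m, hm, h⟩ := exists_sum_ite_eq (n := n) γ' a ha
    refine ⟨m, hm, ?_⟩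
    simp only [hγ, Finset.sum_filter]
    rw [Fin.sum_univ_eq_sum_range (fun j => if a j then γ' j else 0),
      Fin.sum_univ_eq_sum_range (fun j => if j < m then γ' j else 0), h, ← Finset.sum_filter]
    refine Finset.sum_congr ?_ fun _ _ => rfl
    ext j
    simp only [Finset.mem_range, Finset.mem_filter]
    omega
  obtain ⟨a, ha, h1⟩ := key (fun j => ∀ l : Fin n, l.1 ≤ j → w l) fun i j hij h l hl =>
    h l (hl.trans hij)
  obtain ⟨b, hb, h2⟩ := key (fun j => ∀ l : Fin n, l.1 < j → w l) fun i j hij h l hl =>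
    h l (hl.trans_le hij)
  refine ⟨a, ha, b, hb, ?_⟩
  rw [← h1, ← h2, Finset.mul_sum, ← Finset.sum_sub_distrib]
  refine Finset.sum_congr rfl fun i _ => ?_
  by_cases h : ∀ l < i, w l
  · have h' : ∀ l : Fin n, l.1 < i.1 → w l := h
    rw [gain, if_pos h, if_pos h']
    by_cases hi : w i
    · have hall : ∀ l : Fin n, l.1 ≤ i.1 → w l := fun l hl =>
        (lt_or_eq_of_le hl).elim (h' l) fun e => by rwa [Fin.ext e]
      rw [if_pos hall]
      simp only [sgn, hi, if_true]; ring
    · rw [if_neg fun hh => hi (hh i le_rfl)]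
      simp only [sgn, hi]; simp
  · have h' : ¬ ∀ l : Fin n, l.1 < i.1 → w l := h
    rw [gain, if_neg h, if_neg h', if_neg fun hh => h fun l hl => hh l (le_of_lt hl)]
    ring

variable {N n : ℕ}

/-- The outcomes of the first `j` rounds; later rounds are replaced by losses. -/
def truncOutcome (N n j : ℕ) (ω : Fin N → Fin n → Bool) : Fin N → Fin n → Bool :=
  fun k i => if i.1 < j then ω k i else false

/-- The filtration generated by the rounds of `N` gamblers. -/
def outcomeFiltration (N n : ℕ) :
    Filtration ℕ (inferInstance : MeasurableSpace (Fin N → Fin n → Bool)) where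
  seq j := MeasurableSpace.comap (truncOutcome N n j) inferInstance
  mono' i j hij := by
    have h : truncOutcome N n i = truncOutcome N n i ∘ truncOutcome N n j := by
      ext ω k l
      simp only [truncOutcome, Function.comp_apply]
      split_ifs with h1 h2
      · rfl
      · omega
      · rfl
    dsimp only
    rw [h, ← MeasurableSpace.comap_comp]
    exact MeasurableSpace.comap_mono (measurable_of_finite _).comap_le
  le' j := (measurable_of_finite _).comap_le

/-- The total gain in round `j` when the `k`-th gambler's stakes are `x k`. -/
def totalGain (x : Fin N → X) (j : ℕ) (ω : Fin N → Fin n → Bool) : X :=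
  if h : j < n then ∑ k, gain (ω k) ⟨j, h⟩ • x k else 0

theorem totalGain_truncOutcome (x : Fin N → X) (j : ℕ) (ω : Fin N → Fin n → Bool) :
    totalGain x j (truncOutcome N n (j + 1) ω) = totalGain x j ω := by
  unfold totalGain
  split_ifs with h
  · refine Finset.sum_congr rfl fun k _ => ?_
    have h1 : truncOutcome N n (j + 1) ω k ⟨j, h⟩ = ω k ⟨j, h⟩ := by simp [truncOutcome]
    have h2 : (∀ l < (⟨j, h⟩ : Fin n), truncOutcome N n (j + 1) ω k l) ↔
        ∀ l < (⟨j, h⟩ : Fin n), ω k l := forall₂_congr fun l hl => by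
      have : l.1 < j + 1 := (Fin.lt_def.1 hl).trans j.lt_succ_self
      simp [truncOutcome, this]
    simp only [gain, h1, h2]
  · rfl

/-- Reversing the outcomes of round `j`. -/
def flipRound (N n j : ℕ) (ω : Fin N → Fin n → Bool) : Fin N → Fin n → Bool :=
  fun k i => (if i.1 = j then not else id) (ω k i)

theorem measurePreserving_flipRound (j : ℕ) : MeasurePreserving (flipRound N n j)
    (Measure.pi fun _ => coinPi n) (Measure.pi fun _ => coinPi n) := by
  refine measurePreserving_pi (f := fun (_ : Fin N) (w : Fin n → Bool) (i : Fin n) =>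
    (if i.1 = j then not else id) (w i)) _ _ fun k => ?_
  refine measurePreserving_pi _ _ fun i => ?_
  split_ifs
  · exact measurePreserving_not_coin
  · exact MeasurePreserving.id _

theorem totalGain_flipRound (x : Fin N → X) (j : ℕ) (ω : Fin N → Fin n → Bool) :
    totalGain x j (flipRound N n j ω) = -totalGain x j ω := by
  unfold totalGain
  split_ifs with h
  · rw [← Finset.sum_neg_distrib]
    refine Finset.sum_congr rfl fun k _ => ?_
    have h1 : flipRound N n j ω k ⟨j, h⟩ = !ω k ⟨j, h⟩ := by simp [flipRound]
    have h2 : (∀ l < (⟨j, h⟩ : Fin n), flipRound N n j ω k l) ↔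
        ∀ l < (⟨j, h⟩ : Fin n), ω k l := forall₂_congr fun l hl => by
      have : l.1 ≠ j := (Fin.lt_def.1 hl).ne
      simp [flipRound, this]
    simp only [gain, h1, h2, sgn_not]
    split_ifs <;> simp
  · simp

theorem truncOutcome_flipRound (j : ℕ) (ω : Fin N → Fin n → Bool) :
    truncOutcome N n j (flipRound N n j ω) = truncOutcome N n j ω := by
  ext k i
  simp only [truncOutcome, flipRound]
  split_ifs with h1 h2
  · omega
  · rfl
  · rfl

theorem isMartDiffSeq_totalGain [CompleteSpace X] (x : Fin N → X) :
    IsMartDiffSeq (outcomeFiltration N n) (Measure.pi fun _ => coinPi n)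
      (totalGain (n := n) x) := by
  rw [isMartDiffSeq_iff]
  intro j
  have hint : Integrable (totalGain (n := n) x j) (Measure.pi fun _ => coinPi n) :=
    Integrable.of_finite
  refine ⟨?_, hint, ?_⟩
  · have h : totalGain (n := n) x j = totalGain x j ∘ truncOutcome N n (j + 1) :=
      funext fun ω => (totalGain_truncOutcome x j ω).symm
    rw [h]
    exact StronglyMeasurable.of_discrete.comp_measurable (comap_measurable _)
  · refine (ae_eq_condExp_of_forall_setIntegral_eq ((outcomeFiltration N n).le j) hint
      (fun _ _ _ => (integrable_zero _ _ _).integrableOn) (fun s hs _ => ?_)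
      aestronglyMeasurable_zero).symm
    obtain ⟨B, hB, rfl⟩ := hs
    have hpre : flipRound N n j ⁻¹' (truncOutcome N n j ⁻¹' B) = truncOutcome N n j ⁻¹' B := by
      ext ω; simp only [Set.mem_preimage, truncOutcome_flipRound]
    have hinv : Function.Involutive (flipRound N n j) := fun ω => by
      ext k i; simp only [flipRound]; split_ifs <;> simp
    have h := (measurePreserving_flipRound (N := N) (n := n) j).setIntegral_preimage_emb
      (MeasurableEquiv.mk hinv.toPerm (measurable_of_finite _)
        (measurable_of_finite _)).measurableEmbedding (totalGain x j) (truncOutcome N n j ⁻¹' B)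
    simp only [hpre, totalGain_flipRound, integral_neg] at h
    simp only [Pi.zero_apply, integral_zero]
    have h2 := congrArg (fun v => (-2⁻¹ : ℝ) • v) (sub_eq_zero.2 h)
    simp only [smul_zero] at h2
    rw [← h2]
    module

theorem lintegral_radNorm_sum_gain_le [CompleteSpace X] {C : ℝ≥0}
    (hC : MomentBound (gaussNorm X n) 2 C) (x : Fin N → X) :
    ∫⁻ ω, ENNReal.ofReal (radNorm X N fun k => (∑ i, gain (ω k) i) • x k) ^ 2
        ∂(Measure.pi fun _ : Fin N => coinPi n) ≤
      C * ∫⁻ ω, ∫⁻ g, ENNReal.ofReal (radNorm X N fun k => (∑ i, g i * gain (ω k) i) • x k) ^ 2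
        ∂gaussianPi n ∂(Measure.pi fun _ : Fin N => coinPi n) := by
  have h1 : ∀ s : Fin N → Bool,
      ∫⁻ ω, ‖∑ k, sgn (s k) • (∑ i, gain (ω k) i) • x k‖ₑ ^ 2
        ∂(Measure.pi fun _ : Fin N => coinPi n) ≤
      C * ∫⁻ ω, ∫⁻ g, ‖∑ k, sgn (s k) • (∑ i, g i * gain (ω k) i) • x k‖ₑ ^ 2
        ∂gaussianPi n ∂(Measure.pi fun _ : Fin N => coinPi n) := fun s => by
    have h := hC _ _ _ inferInstance _ _ (isMartDiffSeq_totalGain (n := n) fun k => sgn (s k) • x k)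
    have e : ∀ ω (i : Fin n), totalGain (n := n) (fun k => sgn (s k) • x k) i ω =
        ∑ k, gain (ω k) i • sgn (s k) • x k := fun ω i => by simp [totalGain]
    have e1 : ∀ ω : Fin N → Fin n → Bool, ∑ i, ∑ k, gain (ω k) i • sgn (s k) • x k =
        ∑ k, sgn (s k) • (∑ i, gain (ω k) i) • x k := fun ω => by
      simp only [Finset.sum_smul, Finset.smul_sum]
      rw [Finset.sum_comm]
      simp only [smul_comm (sgn _)]
    have e2 : ∀ (ω : Fin N → Fin n → Bool) (g : Fin n → ℝ),
        ∑ i, g i • ∑ k, gain (ω k) i • sgn (s k) • x k =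
        ∑ k, sgn (s k) • (∑ i, g i * gain (ω k) i) • x k := fun ω g => by
      simp only [Finset.sum_smul, Finset.smul_sum]
      rw [Finset.sum_comm]
      simp only [smul_comm (sgn _), mul_smul]
    simpa only [ENNReal.rpow_two, ofReal_gaussNorm_sq, Finset.sum_range, e, e1, e2] using h
  have hm : ∀ (ω : Fin N → Fin n → Bool) (s : Fin N → Bool), Measurable fun g : Fin n → ℝ =>
      ‖∑ k, sgn (s k) • (∑ i, g i * gain (ω k) i) • x k‖ₑ ^ 2 := fun ω s =>
    (Finset.stronglyMeasurable_fun_sum _ fun k _ => ((by fun_prop : Measurable fun g : Fin n → ℝ =>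
      ∑ i, g i * gain (ω k) i).stronglyMeasurable.smul_const (x k)).const_smul
        (sgn (s k))).enorm.pow_const 2
  simp_rw [ofReal_radNorm_sq, lintegral_coinPi]
  simp_rw [← sum_lintegral_div_two_pow (hm _)]
  rw [← sum_lintegral_div_two_pow fun _ => measurable_of_finite _,
    ← sum_lintegral_div_two_pow fun _ => measurable_of_finite _, ← mul_div_assoc, Finset.mul_sum]
  gcongr with s _
  exact h1 s

end Gambling

section Selector

theorem lintegral_exp_mul_sum_gaussianPi {n : ℕ} (s : Finset (Fin n)) (t : ℝ) :
    ∫⁻ g, ENNReal.ofReal (Real.exp (t * ∑ i ∈ s, g i)) ∂gaussianPi n =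
      ENNReal.ofReal (Real.exp (t ^ 2 / 2) ^ s.card) := by
  have hi : iIndepFun (fun (i : Fin n) (g : Fin n → ℝ) => g i) (gaussianPi n) :=
    iIndepFun_pi (μ := fun _ : Fin n => gaussianReal 0 1) (X := fun _ t => t)
      fun _ => measurable_id.aemeasurable
  have h := hi.mgf_sum (t := t) (fun i => measurable_pi_apply i) s
  have h1 : ∀ i : Fin n, mgf (fun g : Fin n → ℝ => g i) (gaussianPi n) t =
      Real.exp (t ^ 2 / 2) := fun i => by
    have hmap : (gaussianPi n).map (fun g => g i) = gaussianReal 0 1 :=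
      (measurePreserving_eval (fun _ : Fin n => gaussianReal 0 1) i).map_eq
    rw [mgf_gaussianReal hmap]
    simp
  simp only [h1, Finset.prod_const] at h
  have hpos : 0 < mgf (∑ i ∈ s, fun g : Fin n → ℝ => g i) (gaussianPi n) t := by
    rw [h]; positivity
  rw [← h, mgf, ofReal_integral_eq_lintegral_ofReal (mgf_pos_iff.1 hpos)
    (Eventually.of_forall fun _ => (Real.exp_pos _).le)]
  simp only [Finset.sum_apply]

theorem pow_four_le_exp (x : ℝ) : x ^ 4 ≤ 24 * (Real.exp x + Real.exp (-x)) := by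
  have h := Real.pow_div_factorial_le_exp |x| (abs_nonneg x) 4
  rw [show ((Nat.factorial 4 : ℕ) : ℝ) = 24 by norm_num [Nat.factorial], pow_abs,
    abs_of_nonneg (by positivity)] at h
  have h1 := Real.exp_pos x
  have h2 := Real.exp_pos (-x)
  rcases abs_cases x with ⟨h3, -⟩ | ⟨h3, -⟩ <;> rw [h3] at h <;> linarith

theorem exp_half_le_two : Real.exp (1 / 2) ≤ 2 := by
  have h : Real.exp (1 / 2) ^ 2 = Real.exp 1 := by rw [← Real.exp_nat_mul]; norm_num
  have h1 := Real.exp_one_lt_d9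
  have h2 := Real.exp_pos (1 / 2)
  nlinarith

theorem lintegral_sum_pow_four_le {n : ℕ} (s : Finset (Fin n)) :
    ∫⁻ g, ENNReal.ofReal ((∑ i ∈ s, g i) ^ 4) ∂gaussianPi n ≤ ENNReal.ofReal (96 * n ^ 2) := by
  rcases Nat.eq_zero_or_pos n with rfl | hn
  · simp [Finset.eq_empty_of_isEmpty s]
  have hn' : (0 : ℝ) < n := Nat.cast_pos.2 hn
  have hc : (√n : ℝ)⁻¹ ^ 2 = (n : ℝ)⁻¹ := by rw [inv_pow, Real.sq_sqrt hn'.le]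
  set c : ℝ := (√n)⁻¹ with hc'
  have hexp : Real.exp (c ^ 2 / 2) ^ s.card ≤ 2 := by
    rw [← Real.exp_nat_mul]
    refine le_trans (Real.exp_le_exp.2 ?_) exp_half_le_two
    have : (s.card : ℝ) ≤ n := by exact_mod_cast (Finset.card_le_univ s).trans (by simp)
    rw [hc]
    calc (s.card : ℝ) * ((n : ℝ)⁻¹ / 2) ≤ n * ((n : ℝ)⁻¹ / 2) := by gcongr
      _ = 1 / 2 := by field_simp
  calc _ ≤ ∫⁻ g, ENNReal.ofReal (24 * n ^ 2) * (ENNReal.ofReal (Real.exp (c * ∑ i ∈ s, g i)) +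
        ENNReal.ofReal (Real.exp (-c * ∑ i ∈ s, g i))) ∂gaussianPi n := by
        refine lintegral_mono fun g => ?_
        rw [← ENNReal.ofReal_add (Real.exp_pos _).le (Real.exp_pos _).le,
          ← ENNReal.ofReal_mul (by positivity)]
        refine ENNReal.ofReal_le_ofReal ?_
        have h4 := pow_four_le_exp (c * ∑ i ∈ s, g i)
        have hc4 : c ^ 4 * (n : ℝ) ^ 2 = 1 := by
          rw [show c ^ 4 = (c ^ 2) ^ 2 by ring, hc]; field_simp
        rw [mul_pow, ← neg_mul] at h4
        calc _ = (n : ℝ) ^ 2 * (c ^ 4 * (∑ i ∈ s, g i) ^ 4) := by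
              rw [← mul_assoc, mul_comm _ (c ^ 4), hc4, one_mul]
          _ ≤ (n : ℝ) ^ 2 * (24 * (Real.exp (c * ∑ i ∈ s, g i) + Real.exp (-c * ∑ i ∈ s, g i))) := by
              gcongr
          _ = _ := by rw [← mul_assoc, mul_comm ((n : ℝ) ^ 2)]
    _ ≤ ENNReal.ofReal (24 * n ^ 2) * (ENNReal.ofReal 2 + ENNReal.ofReal 2) := by
        rw [lintegral_const_mul' _ _ ENNReal.ofReal_ne_top, lintegral_add_left (by fun_prop),
          lintegral_exp_mul_sum_gaussianPi, lintegral_exp_mul_sum_gaussianPi, neg_sq]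
        gcongr
    _ = _ := by
        rw [← ENNReal.ofReal_add zero_le_two zero_le_two, ← ENNReal.ofReal_mul (by positivity)]
        congr 1; ring

/-- The square of the running maximum of a Gaussian random walk, up to the parameter `r`. -/
def walkBound {n : ℕ} (r : ℝ) (g : Fin n → ℝ) : ℝ :=
  9 * (r + ∑ m ∈ Finset.range (n + 1), (∑ i with i.1 < m, g i) ^ 4 / r)

theorem sq_sum_mul_gain_le {n : ℕ} {r : ℝ} (hr : 0 < r) (g : Fin n → ℝ) (w : Fin n → Bool) :
    (∑ i, g i * gain w i) ^ 2 ≤ walkBound r g := by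
  obtain ⟨a, ha, b, hb, h⟩ := exists_sum_mul_gain_eq g w
  have key : ∀ m ≤ n, (∑ i with i.1 < m, g i) ^ 2 ≤
      r + ∑ m ∈ Finset.range (n + 1), (∑ i with i.1 < m, g i) ^ 4 / r := fun m hm => by
    have h1 := Finset.single_le_sum (f := fun m => (∑ i : Fin n with i.1 < m, g i) ^ 4 / r)
      (fun _ _ => by positivity) (Finset.mem_range.2 (Nat.lt_succ_of_le hm))
    refine le_trans ?_ (add_le_add_right h1 r)
    have h2 : (∑ i with i.1 < m, g i) ^ 4 / r * r = (∑ i with i.1 < m, g i) ^ 4 := by field_simp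
    have h3 : 0 ≤ (∑ i with i.1 < m, g i) ^ 4 / r := by positivity
    nlinarith [sq_nonneg ((∑ i with i.1 < m, g i) ^ 2 - r)]
  rw [h, walkBound]
  nlinarith [key a ha, key b hb, sq_nonneg ((∑ i with i.1 < a, g i) + ∑ i with i.1 < b, g i)]

theorem lintegral_walkBound_le {n : ℕ} {r : ℝ} (hr : 0 < r) :
    ∫⁻ g : Fin n → ℝ, ENNReal.ofReal (walkBound r g) ∂gaussianPi n ≤
      ENNReal.ofReal (9 * (r + (n + 1) * (96 * n ^ 2 / r))) := by
  have e : ∀ g : Fin n → ℝ, ENNReal.ofReal (walkBound r g) = ENNReal.ofReal 9 *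
      (ENNReal.ofReal r + ∑ m ∈ Finset.range (n + 1),
        (ENNReal.ofReal r)⁻¹ * ENNReal.ofReal ((∑ i with i.1 < m, g i) ^ 4)) := fun g => by
    rw [walkBound, ENNReal.ofReal_mul (by norm_num), ENNReal.ofReal_add hr.le
      (Finset.sum_nonneg fun _ _ => by positivity), ENNReal.ofReal_sum_of_nonneg
      fun _ _ => by positivity]
    simp only [ENNReal.ofReal_div_of_pos hr, ENNReal.div_eq_inv_mul]
  simp_rw [e]
  rw [lintegral_const_mul' _ _ ENNReal.ofReal_ne_top, lintegral_add_left measurable_const,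
    lintegral_const, measure_univ, mul_one, lintegral_finsetSum _ fun m _ => by fun_prop]
  simp_rw [lintegral_const_mul' (ENNReal.ofReal r)⁻¹ _
    (ENNReal.inv_ne_top.2 (ENNReal.ofReal_pos.2 hr).ne')]
  rw [ENNReal.ofReal_mul (by norm_num), ENNReal.ofReal_add hr.le (by positivity)]
  gcongr
  refine (Finset.sum_le_card_nsmul _ _ _ fun m _ =>
    mul_le_mul_right (lintegral_sum_pow_four_le _) _).trans (le_of_eq ?_)
  rw [Finset.card_range, nsmul_eq_mul, ENNReal.ofReal_mul (p := (n : ℝ) + 1) (by positivity),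
    ENNReal.ofReal_div_of_pos hr, ENNReal.div_eq_inv_mul]
  congr 1
  rw [← ENNReal.ofReal_natCast]
  push_cast; rfl

variable {X : Type*} [NormedAddCommGroup X] [NormedSpace ℝ X]

theorem exists_selector_bound [CompleteSpace X] {C : ℝ≥0}
    (hC : ∀ N, MomentBound (gaussNorm X N) 2 C) :
    ∃ n : ℕ, ∀ (N : ℕ) (x : Fin N → X),
      ∫⁻ ω, ENNReal.ofReal (radNorm X N fun k => if ∀ i, ω k i then x k else 0) ^ 2
        ∂(Measure.pi fun _ : Fin N => coinPi n) ≤ 4⁻¹ * ENNReal.ofReal (radNorm X N x) ^ 2 := by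
  obtain ⟨k, hk⟩ := exists_nat_ge (max 1 (4 * 1737 * (C : ℝ)))
  have hk1 : (1 : ℝ) ≤ k := (le_max_left _ _).trans hk
  have hkC : 4 * 1737 * (C : ℝ) ≤ k := (le_max_right _ _).trans hk
  have hr : (0 : ℝ) < (k : ℝ) ^ 3 := by positivity
  refine ⟨k ^ 2, fun N x => ?_⟩
  have h1 := lintegral_radNorm_sum_gain_le (hC (k ^ 2)) x
  have h2 : ∀ ω : Fin N → Fin (k ^ 2) → Bool,
      ENNReal.ofReal (k ^ 4) * ENNReal.ofReal (radNorm X N fun j => if ∀ i, ω j i then x j else 0) ^ 2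
        ≤ ENNReal.ofReal (radNorm X N fun j => (∑ i, gain (ω j) i) • x j) ^ 2 := fun ω => by
    rw [show ((k : ℝ) ^ 4) = ((k : ℝ) ^ 2) ^ 2 by ring, ENNReal.ofReal_pow (by positivity),
      ← mul_pow, ← ENNReal.ofReal_mul (by positivity)]
    gcongr
    have h3 : (fun j => if ∀ i, ω j i then (∑ i, gain (ω j) i) • x j else 0) =
        ((k : ℝ) ^ 2) • fun j => if ∀ i, ω j i then x j else 0 := by
      ext j
      simp only [Pi.smul_apply]
      split_ifs with h
      · rw [sum_gain_of_forall h]; push_cast; rfl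
      · simp
    have h4 := (isUncond_radNorm N).ite_le (fun j => (∑ i, gain (ω j) i) • x j)
      fun j => ∀ i, ω j i
    rw [h3, map_smul_eq_mul, Real.norm_of_nonneg (by positivity)] at h4
    exact h4
  have h3 : ∀ (ω : Fin N → Fin (k ^ 2) → Bool) (g : Fin (k ^ 2) → ℝ),
      ENNReal.ofReal (radNorm X N fun j => (∑ i, g i * gain (ω j) i) • x j) ^ 2 ≤
        ENNReal.ofReal (walkBound (k ^ 3) g) * ENNReal.ofReal (radNorm X N x) ^ 2 := fun ω g => by
    have hw : 0 ≤ walkBound ((k : ℝ) ^ 3) g := by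
      unfold walkBound
      have : 0 ≤ ∑ m ∈ Finset.range (k ^ 2 + 1), (∑ i with i.1 < m, g i) ^ 4 / (k : ℝ) ^ 3 :=
        Finset.sum_nonneg fun _ _ => by positivity
      positivity
    have h5 := (isUncond_radNorm N).smul_le_mul (c := fun j => ∑ i, g i * gain (ω j) i)
      (fun j => Real.abs_le_sqrt (sq_sum_mul_gain_le hr g (ω j))) (Real.sqrt_nonneg _) x
    refine (pow_le_pow_left' (ENNReal.ofReal_le_ofReal h5) 2).trans (le_of_eq ?_)
    rw [ENNReal.ofReal_mul (Real.sqrt_nonneg _), mul_pow, ← ENNReal.ofReal_pow (Real.sqrt_nonneg _),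
      Real.sq_sqrt hw]
  have h4 := (lintegral_mono (μ := Measure.pi fun _ : Fin N => coinPi (k ^ 2)) h2).trans (h1.trans
    (mul_le_mul_right (lintegral_mono fun ω => lintegral_mono (μ := gaussianPi (k ^ 2)) (h3 ω)) _))
  rw [lintegral_const_mul' _ _ ENNReal.ofReal_ne_top, lintegral_const, measure_univ, mul_one,
    lintegral_mul_const' _ _ (by finiteness)] at h4
  have h5 := h4.trans (mul_le_mul_right (mul_le_mul_left (lintegral_walkBound_le hr) _) _)
  have h6 : (C : ℝ≥0∞) * ENNReal.ofReal (9 * ((k : ℝ) ^ 3 + (((k ^ 2 : ℕ) : ℝ) + 1) *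
      (96 * ((k ^ 2 : ℕ) : ℝ) ^ 2 / (k : ℝ) ^ 3))) ≤ ENNReal.ofReal (k ^ 4) * 4⁻¹ := by
    rw [← ENNReal.ofReal_coe_nnreal, ← ENNReal.ofReal_mul C.coe_nonneg,
      show (4⁻¹ : ℝ≥0∞) = ENNReal.ofReal 4⁻¹ by
        rw [ENNReal.ofReal_inv_of_pos (by norm_num)]; norm_num, ← ENNReal.ofReal_mul (by positivity)]
    refine ENNReal.ofReal_le_ofReal ?_
    have e : 96 * ((k ^ 2 : ℕ) : ℝ) ^ 2 / (k : ℝ) ^ 3 = 96 * k := by push_cast; field_simp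
    rw [e]
    push_cast
    have h7 : 9 * ((k : ℝ) ^ 3 + ((k : ℝ) ^ 2 + 1) * (96 * k)) ≤ 1737 * (k : ℝ) ^ 3 := by
      have : (k : ℝ) * 1 ≤ k * (k : ℝ) ^ 2 := by gcongr; nlinarith
      nlinarith
    calc (C : ℝ) * _ ≤ C * (1737 * (k : ℝ) ^ 3) := by gcongr
      _ = (4 * 1737 * (C : ℝ)) * ((k : ℝ) ^ 3 * 4⁻¹) := by ring
      _ ≤ k * ((k : ℝ) ^ 3 * 4⁻¹) := by gcongr
      _ = (k : ℝ) ^ 4 * 4⁻¹ := by ring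
  have h7 := h5.trans ((mul_assoc _ _ _).symm.le.trans (mul_le_mul_left h6 _))
  rw [mul_assoc] at h7
  exact (ENNReal.mul_le_mul_iff_right (ENNReal.ofReal_pos.2 (by positivity :
    (0 : ℝ) < (k : ℝ) ^ 4)).ne' ENNReal.ofReal_ne_top).1 h7

end Selector

section Thinning

theorem ext_bool_of_isProbabilityMeasure {ν ν' : Measure Bool} [IsProbabilityMeasure ν]
    [IsProbabilityMeasure ν'] (h : ν {true} = ν' {true}) : ν = ν' := by
  refine Measure.ext_of_singleton fun b => ?_
  cases b
  · have e : ({false} : Set Bool) = {true}ᶜ := by ext b; simp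
    rw [e, prob_compl_eq_one_sub (measurableSet_singleton _),
      prob_compl_eq_one_sub (measurableSet_singleton _), h]
  · exact h

/-- The Bernoulli law on `Bool` giving mass `t` to `true`. -/
def bernoulliBool (t : ℝ≥0∞) : Measure Bool :=
  t • Measure.dirac true + (1 - t) • Measure.dirac false

theorem isProbabilityMeasure_bernoulliBool {t : ℝ≥0∞} (ht : t ≤ 1) :
    IsProbabilityMeasure (bernoulliBool t) :=
  ⟨by simp [bernoulliBool, add_tsub_cancel_of_le ht]⟩

theorem bernoulliBool_true (t : ℝ≥0∞) : bernoulliBool t {true} = t := by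
  simp [bernoulliBool]

variable {X : Type*} [NormedAddCommGroup X] [NormedSpace ℝ X] {N : ℕ}

/-- The second moment of the Rademacher norm of a random selection of the vectors `x k`, with
independent selectors of law `ν`. -/
def selectMean (ν : Measure Bool) (x : Fin N → X) : ℝ≥0∞ :=
  ∫⁻ b, ENNReal.ofReal (radNorm X N fun k => if b k then x k else 0) ^ 2
    ∂(Measure.pi fun _ : Fin N => ν)

theorem selectMean_map {E : Type*} [MeasurableSpace E] {ν : Measure E} [IsProbabilityMeasure ν]
    {φ : E → Bool} (hφ : Measurable φ) (x : Fin N → X) :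
    selectMean (ν.map φ) x =
      ∫⁻ g, ENNReal.ofReal (radNorm X N fun k => if φ (g k) then x k else 0) ^ 2
        ∂(Measure.pi fun _ : Fin N => ν) := by
  have := Measure.isProbabilityMeasure_map (μ := ν) hφ.aemeasurable
  have h := Measure.pi_map_pi (μ := fun _ : Fin N => ν) (f := fun _ => φ) fun _ => hφ.aemeasurable
  rw [selectMean, ← h, lintegral_map (measurable_of_finite _) (by fun_prop)]

theorem selectMean_prod (ν ν' : Measure Bool) [IsProbabilityMeasure ν] [IsProbabilityMeasure ν']
    (x : Fin N → X) : selectMean ((ν.prod ν').map fun p => p.1 && p.2) x =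
      ∫⁻ b, selectMean ν' (fun k => if b k then x k else 0) ∂(Measure.pi fun _ : Fin N => ν) := by
  rw [selectMean_map (measurable_of_finite _)]
  have h := measurePreserving_arrowProdEquivProdArrow Bool Bool (Fin N) (fun _ => ν) fun _ => ν'
  have h2 := h.lintegral_comp (f := fun p : (Fin N → Bool) × (Fin N → Bool) =>
    ENNReal.ofReal (radNorm X N fun k => if p.1 k && p.2 k then x k else 0) ^ 2)
    (measurable_of_finite _)
  refine Eq.trans ?_ (h2.trans ?_)
  · rfl
  · rw [lintegral_prod _ (measurable_of_finite _).aemeasurable]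
    refine lintegral_congr fun b => lintegral_congr fun b' => ?_
    congr 3
    ext k
    by_cases h1 : b k <;> by_cases h2 : b' k <;> simp [h1, h2]

theorem selectMean_le (ν : Measure Bool) [IsProbabilityMeasure ν] (x : Fin N → X) :
    selectMean ν x ≤ ENNReal.ofReal (radNorm X N x) ^ 2 := by
  have h : ∀ b : Fin N → Bool, ENNReal.ofReal (radNorm X N fun k => if b k then x k else 0) ^ 2 ≤
      ENNReal.ofReal (radNorm X N x) ^ 2 := fun b => by
    gcongr
    exact (isUncond_radNorm N).ite_le x fun k => b k = true
  refine (lintegral_mono h).trans (le_of_eq ?_)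
  rw [lintegral_const, measure_univ, mul_one]

theorem prod_map_and_true (ν ν' : Measure Bool) [IsProbabilityMeasure ν]
    [IsProbabilityMeasure ν'] :
    (ν.prod ν').map (fun p => p.1 && p.2) {true} = ν {true} * ν' {true} := by
  rw [Measure.map_apply (measurable_of_finite _) (measurableSet_singleton _), ← Measure.prod_prod]
  congr 1
  ext ⟨b, b'⟩
  simp

theorem selectMean_mono {ν ν' : Measure Bool} [IsProbabilityMeasure ν] [IsProbabilityMeasure ν']
    (h : ν {true} ≤ ν' {true}) (x : Fin N → X) : selectMean ν x ≤ selectMean ν' x := by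
  have hu : ν {true} / ν' {true} ≤ 1 := ENNReal.div_le_of_le_mul (by rwa [one_mul])
  have := isProbabilityMeasure_bernoulliBool hu
  have : IsProbabilityMeasure ((ν'.prod (bernoulliBool (ν {true} / ν' {true}))).map
      fun p => p.1 && p.2) :=
    Measure.isProbabilityMeasure_map (measurable_of_finite _).aemeasurable
  have e : ν = (ν'.prod (bernoulliBool (ν {true} / ν' {true}))).map fun p => p.1 && p.2 := by
    refine ext_bool_of_isProbabilityMeasure ?_
    rw [prod_map_and_true, bernoulliBool_true]
    rcases eq_or_ne (ν' {true}) 0 with h0 | h0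
    · rw [h0, zero_mul]; exact le_zero_iff.1 (h0 ▸ h)
    · rw [ENNReal.mul_div_cancel h0 (measure_ne_top _ _)]
  rw [e, selectMean_prod]
  exact lintegral_mono fun b => selectMean_le _ _

theorem selectMean_bernoulliBool_pow_le {t : ℝ≥0∞} (ht : t ≤ 1) {c : ℝ≥0∞}
    (h : ∀ x : Fin N → X, selectMean (bernoulliBool t) x ≤
      c * ENNReal.ofReal (radNorm X N x) ^ 2) (m : ℕ) (x : Fin N → X) :
    selectMean (bernoulliBool (t ^ m)) x ≤ c ^ m * ENNReal.ofReal (radNorm X N x) ^ 2 := by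
  have := isProbabilityMeasure_bernoulliBool ht
  induction m with
  | zero =>
    have := isProbabilityMeasure_bernoulliBool (pow_le_one₀ (n := 0) zero_le ht)
    rw [pow_zero c, one_mul]
    exact selectMean_le (bernoulliBool (t ^ 0)) x
  | succ m ih =>
    have := isProbabilityMeasure_bernoulliBool (pow_le_one₀ (n := m) zero_le ht)
    have := isProbabilityMeasure_bernoulliBool (pow_le_one₀ (n := m + 1) zero_le ht)
    have : IsProbabilityMeasure (((bernoulliBool (t ^ m)).prod (bernoulliBool t)).map
        fun p => p.1 && p.2) :=
      Measure.isProbabilityMeasure_map (measurable_of_finite _).aemeasurable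
    have e : bernoulliBool (t ^ (m + 1)) =
        ((bernoulliBool (t ^ m)).prod (bernoulliBool t)).map fun p => p.1 && p.2 := by
      refine ext_bool_of_isProbabilityMeasure ?_
      rw [prod_map_and_true]
      simp only [bernoulliBool_true, pow_succ]
    rw [e, selectMean_prod]
    refine (lintegral_mono fun b => h _).trans ?_
    rw [lintegral_const_mul _ (measurable_of_finite _), pow_succ', mul_assoc]
    gcongr
    exact ih

theorem gaussianReal_tail_le (n m : ℕ) :
    gaussianReal 0 1 {t : ℝ | ((n : ℝ) + 2) * m < |t|} ≤ ((2 : ℝ≥0∞)⁻¹ ^ n) ^ m := by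
  rcases Nat.eq_zero_or_pos m with rfl | hm
  · simpa using prob_le_one
  have hexp : ∫⁻ t, ENNReal.ofReal (Real.exp |t|) ∂gaussianReal 0 1 ≤ 4 := by
    have key : ∀ c : ℝ, c ^ 2 = 1 →
        ∫⁻ t, ENNReal.ofReal (Real.exp (c * t)) ∂gaussianReal 0 1 ≤ ENNReal.ofReal 2 :=
      fun c hc => by
        have h : mgf (fun t => t) (gaussianReal 0 1) c = Real.exp (1 / 2) := by
          rw [mgf_fun_id_gaussianReal]; simp [hc]
        have hpos : 0 < mgf (fun t => t) (gaussianReal 0 1) c := by rw [h]; positivity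
        rw [← ofReal_integral_eq_lintegral_ofReal (mgf_pos_iff.1 hpos)
          (Eventually.of_forall fun _ => (Real.exp_pos _).le)]
        exact ENNReal.ofReal_le_ofReal (h.trans_le exp_half_le_two)
    calc _ ≤ ∫⁻ t, (ENNReal.ofReal (Real.exp (1 * t)) + ENNReal.ofReal (Real.exp (-1 * t)))
          ∂gaussianReal 0 1 := by
          refine lintegral_mono fun t => ?_
          dsimp only
          rcases abs_cases t with ⟨h, -⟩ | ⟨h, -⟩ <;> rw [h]
          · rw [one_mul]; exact le_self_add
          · rw [neg_one_mul]; exact le_add_self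
      _ ≤ ENNReal.ofReal 2 + ENNReal.ofReal 2 := by
          rw [lintegral_add_left (by fun_prop)]
          exact add_le_add (key 1 (by norm_num)) (key (-1) (by norm_num))
      _ = 4 := by rw [← ENNReal.ofReal_add zero_le_two zero_le_two]; norm_num
  set c : ℝ≥0∞ := ENNReal.ofReal (Real.exp (((n : ℝ) + 2) * m)) with hc
  have hc0 : c ≠ 0 := (ENNReal.ofReal_pos.2 (Real.exp_pos _)).ne'
  have h1 : gaussianReal 0 1 {t : ℝ | ((n : ℝ) + 2) * m < |t|} ≤ 4 / c := by
    refine (measure_mono fun t ht => ?_).trans ((meas_ge_le_lintegral_div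
      (f := fun t => ENNReal.ofReal (Real.exp |t|)) (by fun_prop) hc0
      ENNReal.ofReal_ne_top).trans (ENNReal.div_le_div_right hexp c))
    exact ENNReal.ofReal_le_ofReal (Real.exp_le_exp.2 (le_of_lt ht))
  refine h1.trans (ENNReal.div_le_of_le_mul ?_)
  have h2 : (2 : ℝ≥0∞) ^ ((n + 2) * m) ≤ c := by
    have : (2 : ℝ) ^ ((n + 2) * m) ≤ Real.exp (((n : ℝ) + 2) * m) := by
      have h3 : (2 : ℝ) ≤ Real.exp 1 := by have := Real.add_one_le_exp (1 : ℝ); linarith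
      have h4 : Real.exp (((n : ℝ) + 2) * m) = Real.exp 1 ^ ((n + 2) * m) := by
        rw [← Real.exp_nat_mul]; push_cast; ring_nf
      rw [h4]
      gcongr
    have h3 := ENNReal.ofReal_le_ofReal this
    rwa [ENNReal.ofReal_pow zero_le_two, ENNReal.ofReal_ofNat] at h3
  calc (4 : ℝ≥0∞) = 2 ^ 2 := by norm_num
    _ ≤ 2 ^ (2 * m) := pow_le_pow_right₀ one_le_two (by omega)
    _ = (2⁻¹ ^ n) ^ m * 2 ^ ((n + 2) * m) := by
        rw [add_mul, pow_add, ← pow_mul, ← mul_assoc, ← mul_pow,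
          ENNReal.inv_mul_cancel two_ne_zero ENNReal.ofNat_ne_top, one_pow, one_mul]
    _ ≤ _ := by gcongr

theorem min_le_sum_ite_lt (c : ℝ) (M : ℕ) :
    min c M ≤ ∑ m ∈ Finset.range M, if (m : ℝ) < c then (1 : ℝ) else 0 := by
  induction M with
  | zero => simp
  | succ M ih =>
    rw [Finset.sum_range_succ]
    push_cast
    split_ifs with h
    · rw [min_eq_right h.le] at ih
      exact (min_le_right _ _).trans (by linarith)
    · rw [min_eq_left (not_lt.1 h)] at ih
      exact (min_le_left _ _).trans (by linarith)

theorem sq_sum_range_le (a : ℕ → ℝ) (M : ℕ) :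
    (∑ m ∈ Finset.range M, a m) ^ 2 ≤ ∑ m ∈ Finset.range M, 2 ^ (m + 1) * a m ^ 2 := by
  induction M generalizing a with
  | zero => simp
  | succ M ih =>
    rw [Finset.sum_range_succ', Finset.sum_range_succ']
    have h := ih fun m => a (m + 1)
    have e : ∑ m ∈ Finset.range M, 2 ^ (m + 1 + 1) * a (m + 1) ^ 2 =
        2 * ∑ m ∈ Finset.range M, 2 ^ (m + 1) * a (m + 1) ^ 2 := by
      rw [Finset.mul_sum]
      exact Finset.sum_congr rfl fun m _ => by ring
    rw [e, zero_add, pow_one]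
    nlinarith [sq_nonneg ((∑ m ∈ Finset.range M, a (m + 1)) - a 0)]

theorem IsUncond.smul_mono {S : Seminorm ℝ (Fin N → X)} (hS : IsUncond S) {a b : Fin N → ℝ}
    (h : ∀ i, |a i| ≤ b i) (x : Fin N → X) : S (fun i => a i • x i) ≤ S (fun i => b i • x i) := by
  refine le_trans (le_of_eq ?_) (hS.smul_le (fun i => b i • x i) (c := fun i => a i / b i)
    fun i => ?_)
  · congr 1; ext i
    rw [smul_smul]
    rcases eq_or_ne (b i) 0 with h0 | h0
    · rw [abs_nonpos_iff.1 ((h i).trans h0.le)]; simp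
    · rw [div_mul_cancel₀ _ h0]
  · rw [abs_div]
    exact div_le_one_of_le₀ ((h i).trans (le_abs_self _)) (abs_nonneg _)

theorem radNorm_smul_sq_le_tsum {T : ℝ} (hT : 0 < T) (g : Fin N → ℝ) (x : Fin N → X) :
    ENNReal.ofReal (radNorm X N fun k => g k • x k) ^ 2 ≤ ENNReal.ofReal T ^ 2 * ∑' m : ℕ,
      2 ^ (m + 1) * ENNReal.ofReal (radNorm X N fun k => if T * m < |g k| then x k else 0) ^ 2 := by
  obtain ⟨M, hM⟩ : ∃ M : ℕ, ∀ k, |g k| / T ≤ M := by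
    obtain ⟨M, hM⟩ := exists_nat_ge (∑ k, |g k| / T)
    exact ⟨M, fun k => (Finset.single_le_sum (f := fun k => |g k| / T)
      (fun _ _ => by positivity) (Finset.mem_univ k)).trans hM⟩
  set a : ℕ → ℝ := fun m => radNorm X N fun k => if T * m < |g k| then x k else 0 with ha
  have h1 : radNorm X N (fun k => g k • x k) ≤ T * ∑ m ∈ Finset.range M, a m := by
    calc _ ≤ radNorm X N fun k =>
          (T * ∑ m ∈ Finset.range M, if T * m < |g k| then (1 : ℝ) else 0) • x k := by
          refine (isUncond_radNorm N).smul_mono (fun k => ?_) x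
          have h := min_le_sum_ite_lt (|g k| / T) M
          rw [min_eq_left (hM k), div_le_iff₀' hT] at h
          simpa only [lt_div_iff₀' hT] using h
      _ = T * radNorm X N (∑ m ∈ Finset.range M, fun k => if T * m < |g k| then x k else 0) := by
          rw [← Real.norm_of_nonneg hT.le, ← map_smul_eq_mul, Real.norm_of_nonneg hT.le]
          congr 1; ext k
          simp only [Pi.smul_apply, Finset.sum_apply, mul_smul, Finset.sum_smul, ite_smul, one_smul,
            zero_smul]
      _ ≤ _ := by
          gcongr
          exact Finset.le_sum_of_subadditive _ (map_zero _).le (map_add_le_add _) _ _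
  calc _ ≤ ENNReal.ofReal (T * ∑ m ∈ Finset.range M, a m) ^ 2 := by gcongr
    _ = ENNReal.ofReal T ^ 2 * ENNReal.ofReal ((∑ m ∈ Finset.range M, a m) ^ 2) := by
        rw [ENNReal.ofReal_mul hT.le, mul_pow, ENNReal.ofReal_pow
          (Finset.sum_nonneg fun m _ => apply_nonneg _ _)]
    _ ≤ ENNReal.ofReal T ^ 2 * ∑ m ∈ Finset.range M, 2 ^ (m + 1) * ENNReal.ofReal (a m) ^ 2 := by
        gcongr
        refine (ENNReal.ofReal_le_ofReal (sq_sum_range_le a M)).trans (le_of_eq ?_)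
        rw [ENNReal.ofReal_sum_of_nonneg fun m _ => by positivity]
        refine Finset.sum_congr rfl fun m _ => ?_
        rw [ENNReal.ofReal_mul (by positivity), ENNReal.ofReal_pow zero_le_two,
          ENNReal.ofReal_pow (apply_nonneg _ _), ENNReal.ofReal_ofNat]
    _ ≤ _ := by
        gcongr
        exact ENNReal.sum_le_tsum _

theorem exists_gaussNorm_sq_le_radNorm_sq [CompleteSpace X] {C : ℝ≥0}
    (hC : ∀ N, MomentBound (gaussNorm X N) 2 C) :
    ∃ K : ℝ≥0, ∀ (N : ℕ) (x : Fin N → X),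
      ENNReal.ofReal (gaussNorm X N x) ^ 2 ≤ K * ENNReal.ofReal (radNorm X N x) ^ 2 := by
  obtain ⟨n, hn⟩ := exists_selector_bound hC
  have ht : (2 : ℝ≥0∞)⁻¹ ^ n ≤ 1 := pow_le_one₀ zero_le (ENNReal.inv_le_one.2 one_le_two)
  refine ⟨4 * ((n : ℝ≥0) + 2) ^ 2, fun N x => ?_⟩
  have hsel : ∀ x : Fin N → X, selectMean (bernoulliBool (2⁻¹ ^ n)) x ≤
      4⁻¹ * ENNReal.ofReal (radNorm X N x) ^ 2 := fun x => by
    have hφ : Measurable fun w : Fin n → Bool => decide (∀ i, w i) := measurable_of_finite _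
    have := isProbabilityMeasure_bernoulliBool ht
    have := Measure.isProbabilityMeasure_map (μ := coinPi n) hφ.aemeasurable
    have e : bernoulliBool (2⁻¹ ^ n) = (coinPi n).map fun w => decide (∀ i, w i) := by
      refine ext_bool_of_isProbabilityMeasure ?_
      have hpre : (fun w : Fin n → Bool => decide (∀ i, w i)) ⁻¹' {true} = {fun _ => true} := by
        ext w; simp [funext_iff]
      rw [bernoulliBool_true, Measure.map_apply hφ (measurableSet_singleton _), hpre, coinPi,
        Measure.pi_singleton]
      simp [coin_singleton]
    rw [e, selectMean_map hφ]
    simpa using hn N x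
  have hT : (0 : ℝ) < (n : ℝ) + 2 := by positivity
  have htail : ∀ m : ℕ, ∫⁻ g : Fin N → ℝ, ENNReal.ofReal
      (radNorm X N fun k => if ((n : ℝ) + 2) * m < |g k| then x k else 0) ^ 2 ∂gaussianPi N ≤
      4⁻¹ ^ m * ENNReal.ofReal (radNorm X N x) ^ 2 := fun m => by
    have hA : MeasurableSet {t : ℝ | ((n : ℝ) + 2) * m < |t|} :=
      measurableSet_lt measurable_const (by fun_prop)
    have hφ : Measurable fun t : ℝ => decide (((n : ℝ) + 2) * m < |t|) :=
      measurable_to_bool (by simpa [Set.preimage] using hA)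
    have := isProbabilityMeasure_bernoulliBool (pow_le_one₀ (n := m) zero_le ht)
    have := Measure.isProbabilityMeasure_map (μ := gaussianReal 0 1) hφ.aemeasurable
    refine le_trans (le_of_eq ?_) ((selectMean_mono
      (ν := (gaussianReal 0 1).map fun t : ℝ => decide (((n : ℝ) + 2) * m < |t|))
      (ν' := bernoulliBool ((2⁻¹ ^ n) ^ m)) ?_ x).trans
      (selectMean_bernoulliBool_pow_le ht hsel m x))
    · rw [selectMean_map hφ]
      simp only [decide_eq_true_eq]
      rfl
    · rw [bernoulliBool_true, Measure.map_apply hφ (measurableSet_singleton _)]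
      refine le_trans (le_of_eq ?_) (gaussianReal_tail_le n m)
      congr 1; ext t; simp
  have hmeas : ∀ m : ℕ, Measurable fun g : Fin N → ℝ => (2 : ℝ≥0∞) ^ (m + 1) * ENNReal.ofReal
      (radNorm X N fun k => if ((n : ℝ) + 2) * m < |g k| then x k else 0) ^ 2 := fun m => by
    refine ((isUncond_radNorm N).measurable fun k => ?_).ennreal_ofReal.pow_const 2 |>.const_mul _
    exact StronglyMeasurable.ite (measurableSet_lt measurable_const (by fun_prop))
      stronglyMeasurable_const stronglyMeasurable_const
  rw [← lintegral_radNorm_smul_sq]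
  refine (lintegral_mono fun g => radNorm_smul_sq_le_tsum hT g x).trans ?_
  rw [lintegral_const_mul' _ _ (by finiteness), lintegral_tsum fun m => (hmeas m).aemeasurable]
  have hsum : ∑' m : ℕ, (2 : ℝ≥0∞) ^ (m + 1) * (4⁻¹ ^ m * ENNReal.ofReal (radNorm X N x) ^ 2) =
      4 * ENNReal.ofReal (radNorm X N x) ^ 2 := by
    have e : ∀ m : ℕ, (2 : ℝ≥0∞) ^ (m + 1) * (4⁻¹ ^ m * ENNReal.ofReal (radNorm X N x) ^ 2) =
        2⁻¹ ^ m * (2 * ENNReal.ofReal (radNorm X N x) ^ 2) := fun m => by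
      have h4 : (4 : ℝ≥0∞)⁻¹ = 2⁻¹ * 2⁻¹ := by
        rw [← ENNReal.mul_inv (by simp) (by simp)]; norm_num
      have h2 : (2 : ℝ≥0∞) ^ m * 2⁻¹ ^ m = 1 := by
        rw [← mul_pow, ENNReal.mul_inv_cancel two_ne_zero ENNReal.ofNat_ne_top, one_pow]
      rw [h4, mul_pow, pow_succ]
      calc _ = ((2 : ℝ≥0∞) ^ m * 2⁻¹ ^ m) * (2⁻¹ ^ m * (2 * ENNReal.ofReal (radNorm X N x) ^ 2)) := by
            ring
        _ = _ := by rw [h2, one_mul]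
    simp_rw [e]
    rw [ENNReal.tsum_mul_right, ENNReal.tsum_geometric, ENNReal.one_sub_inv_two, inv_inv,
      ← mul_assoc]
    norm_num
  have hn2 : ENNReal.ofReal ((n : ℝ) + 2) = (n : ℝ≥0∞) + 2 := by
    rw [ENNReal.ofReal_add (by positivity) zero_le_two, ENNReal.ofReal_natCast,
      ENNReal.ofReal_ofNat]
  calc _ ≤ ENNReal.ofReal ((n : ℝ) + 2) ^ 2 *
        ∑' m : ℕ, (2 : ℝ≥0∞) ^ (m + 1) * (4⁻¹ ^ m * ENNReal.ofReal (radNorm X N x) ^ 2) := by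
        gcongr with m
        rw [lintegral_const_mul' _ _ (by finiteness)]
        gcongr
        exact htail m
    _ = _ := by
        rw [hsum, hn2]
        push_cast
        ring

end Thinning

section Characterization

variable {X : Type*} [NormedAddCommGroup X] [NormedSpace ℝ X] [CompleteSpace X]

theorem isUMDminus_of_one_sided_bdg {p C : ℝ} (hp : 1 ≤ p)
    (h : ∀ (Ω : Type) (m : MeasurableSpace Ω) (P : Measure Ω), IsProbabilityMeasure P →
      ∀ (ℱ : Filtration ℕ m) (d : ℕ → Ω → X), IsMartDiffSeq ℱ P d →
        (∫⁻ ω, (⨆ M : ℕ, (‖∑ n ∈ Finset.range M, d n ω‖₊ : ℝ≥0∞)) ^ p ∂P) ≤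
          ENNReal.ofReal C * ∫⁻ ω, gammaSeqNorm (fun n => d n ω) ^ p ∂P) :
    IsUMDminus X := by
  obtain ⟨C₂, hC₂⟩ := exists_momentBound_of_momentBound (by linarith) one_le_two
    isUncond_gaussNorm (momentBound_gaussNorm_of_one_sided_bdg hp h)
  obtain ⟨K, hK⟩ := exists_gaussNorm_sq_le_radNorm_sq hC₂
  refine isUMDminus_of_momentBound_radNorm (C := C₂ * K) fun N Ω m P _ ℱ d hd => ?_
  refine (hC₂ N Ω m P inferInstance ℱ d hd).trans ?_
  rw [ENNReal.coe_mul, mul_assoc, ← lintegral_const_mul' (K : ℝ≥0∞) _ ENNReal.coe_ne_top]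
  refine mul_le_mul' le_rfl (lintegral_mono fun ω => ?_)
  simpa only [ENNReal.rpow_two] using hK N fun i => d i ω

end Characterization

/-- **One-sided discrete BDG estimates characterize UMD⁻** (Theorem 6.13).
Let `X` be a Banach space and `1 ≤ p < ∞`. Then `X` is UMD⁻ if and only if
`E sup_m ‖Σ_{n≤m} d_n‖^p ≲_{p,X} E ‖(d_n)‖_{γ(ℓ²,X)}^p` for every `X`-valued martingale
difference sequence `(d_n)`. -/
theorem umd_minus_iff_one_sided_bdg
    (X : Type*) [NormedAddCommGroup X] [NormedSpace ℝ X] [CompleteSpace X]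
    (p : ℝ) (hp : 1 ≤ p) :
    IsUMDminus X ↔
      ∃ C : ℝ, 0 < C ∧
        ∀ (Ω : Type) (m : MeasurableSpace Ω) (P : Measure Ω), IsProbabilityMeasure P →
          ∀ (ℱ : Filtration ℕ m) (d : ℕ → Ω → X), IsMartDiffSeq ℱ P d →
            (∫⁻ ω, (⨆ M : ℕ, (‖∑ n ∈ Finset.range M, d n ω‖₊ : ℝ≥0∞)) ^ p ∂P) ≤
              ENNReal.ofReal C * ∫⁻ ω, gammaSeqNorm (fun n => d n ω) ^ p ∂P := by
  exact ⟨fun h => h.one_sided_bdg hp, fun ⟨_, _, h⟩ => isUMDminus_of_one_sided_bdg hp h⟩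

end
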